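/- (Compactness of the set of minimizing extremals, Lemma 3.6.) For all compact sets K₁, K₂ ⊆ ℝⁿ, the set Γ^min_{K₁,K₂} of minimizing extremals from K₁ to K₂ is compact in (C([a,b];ℝⁿ), d_Γ). -/

import Mathlib

open MeasureTheory Filter Topology
open scoped ENNReal NNReal

noncomputable section

/-- Euclidean space `ℝⁿ`. -/
abbrev Eu (n : ℕ) := EuclideanSpace ℝ (Fin n)

/-- The space `C([a,b];ℝⁿ)` of continuous curves with the supremum metric. -/
abbrev CPath (a b : ℝ) (n : ℕ) := C(Set.Icc a b, Eu n)

/-- We endow the path space with its Borel σ-algebra. -/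
noncomputable instance pathMeasurableSpace (a b : ℝ) (n : ℕ) :
    MeasurableSpace (CPath a b n) := borel _

instance pathBorelSpace (a b : ℝ) (n : ℕ) : BorelSpace (CPath a b n) :=
  ⟨rfl⟩

/-- Evaluation of a curve at time `t ∈ [a,b]` (junk value `0` outside `[a,b]`). -/
def pev {a b : ℝ} {n : ℕ} (γ : CPath a b n) (t : ℝ) : Eu n :=
  if ht : t ∈ Set.Icc a b then γ ⟨t, ht⟩ else 0

/-- A curve is absolutely continuous if it has a Bochner-integrable derivative `g` with
`γ t = γ s + ∫_s^t g`. -/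
def IsACC {a b : ℝ} {n : ℕ} (γ : CPath a b n) : Prop :=
  ∃ g : ℝ → Eu n, IntegrableOn g (Set.Icc a b) ∧
    ∀ s t : Set.Icc a b, γ t = γ s + ∫ u in (s : ℝ)..(t : ℝ), g u

open Classical in
/-- The action `𝒜(γ) = ∫_a^b L(γ(t), γ̇(t)) dt ∈ (−∞,+∞]`, equal to `+∞` on curves that are
not absolutely continuous (and, by the convention that the integral is `+∞` when the
integrand fails to be integrable -- its negative part being automatically integrable --
also on absolutely continuous curves with non-integrable Lagrangian). -/
def action {n : ℕ} (L : Eu n → Eu n → ℝ) (a b : ℝ) (γ : CPath a b n) : EReal :=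
  if h : IsACC γ then
    (if IntegrableOn (fun t => L (pev γ t) (h.choose t)) (Set.Icc a b) then
      (((∫ t in Set.Icc a b, L (pev γ t) (h.choose t)) : ℝ) : EReal)
    else ⊤)
  else ⊤

/-- Positive part of an extended real, as `ℝ≥0∞`. -/
def epos (x : EReal) : ℝ≥0∞ := if x = ⊤ then ⊤ else ENNReal.ofReal x.toReal

/-- The integral `∫ F dπ ∈ [−∞,+∞]` of an extended-real-valued function, defined as the
difference of the lower integrals of the positive and negative parts. -/
def mint {X : Type*} [MeasurableSpace X] (F : X → EReal) (π : Measure X) : EReal :=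
  ((∫⁻ γ, epos (F γ) ∂π : ℝ≥0∞) : EReal) - ((∫⁻ γ, epos (-(F γ)) ∂π : ℝ≥0∞) : EReal)

open Classical in
/-- The constrained functional `𝔸_{μa,μb}(π) = ∫ 𝒜 dπ` if `pr_a#π = μa` and `pr_b#π = μb`,
and `+∞` otherwise, for a given (extended-real-valued) action functional `F`. -/
def aFun {a b : ℝ} {n : ℕ} (F : CPath a b n → EReal) (μa μb : Measure (Eu n))
    (π : Measure (CPath a b n)) : EReal :=
  if Measure.map (fun γ => pev γ a) π = μa ∧ Measure.map (fun γ => pev γ b) π = μb then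
    mint F π
  else ⊤

/-- Weak convergence of a sequence of measures: convergence of the integrals of all bounded
continuous functions. -/
def WeakLim {X : Type*} [TopologicalSpace X] [MeasurableSpace X]
    (πs : ℕ → Measure X) (π : Measure X) : Prop :=
  ∀ φ : BoundedContinuousFunction X ℝ,
    Tendsto (fun N => ∫ x, φ x ∂(πs N)) atTop (𝓝 (∫ x, φ x ∂π))

/-- The empirical measure `(1/N) ∑_{i=1}^N δ_{x i}`. -/
def emp {X : Type*} [MeasurableSpace X] (N : ℕ) (x : Fin N → X) : Measure X :=
  (N : ℝ≥0∞)⁻¹ • ∑ i : Fin N, Measure.dirac (x i)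

/-- The topological support of a measure. -/
def msupp {α : Type*} [TopologicalSpace α] [MeasurableSpace α] (μ : Measure α) : Set α :=
  {x | ∀ U : Set α, IsOpen U → x ∈ U → 0 < μ U}

/-- The set `Γ^min_{K₁,K₂}` of minimizing extremals starting in `K₁` and ending in `K₂`. -/
def GammaMin {n : ℕ} (L : Eu n → Eu n → ℝ) (a b : ℝ) (K₁ K₂ : Set (Eu n)) :
    Set (CPath a b n) :=
  {γ | IsACC γ ∧ pev γ a ∈ K₁ ∧ pev γ b ∈ K₂ ∧
    ∀ γ' : CPath a b n, IsACC γ' → pev γ' a = pev γ a → pev γ' b = pev γ b →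
      action L a b γ ≤ action L a b γ'}

/-- The Lagrangian cost `c(x,y)`: the minimal action among absolutely continuous curves
from `x` to `y`. -/
def cost {n : ℕ} (L : Eu n → Eu n → ℝ) (a b : ℝ) (x y : Eu n) : EReal :=
  ⨅ γ ∈ {γ : CPath a b n | IsACC γ ∧ pev γ a = x ∧ pev γ b = y}, action L a b γ

/-- The restriction of a continuous curve `ℝ → ℝⁿ` to `[a,b]` as an element of the path
space. -/
def toPath {n : ℕ} (a b : ℝ) (f : ℝ → Eu n) (hf : Continuous f) : CPath a b n :=
  (ContinuousMap.mk f hf).restrict (Set.Icc a b)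

/-- `Φ : ℝⁿ × ℝⁿ → C([a,b];ℝⁿ)` is the Euler–Lagrange (Newton) flow map for the Lagrangian
`L(x,v) = (m/2)|v|² − V(x)`: it is continuous and `Φ(x,v)` is a `C²` solution of
`m γ'' = −∇V(γ)` with initial position `x` and initial velocity `v`. -/
def IsNewtonFlow {n : ℕ} (m : ℝ) (V : Eu n → ℝ) (a b : ℝ)
    (Φ : Eu n × Eu n → CPath a b n) : Prop :=
  Continuous Φ ∧ ∀ x v : Eu n, ∃ f : ℝ → Eu n, ContDiff ℝ 2 f ∧
    (∀ t : Set.Icc a b, Φ (x, v) t = f t) ∧ f a = x ∧ deriv f a = v ∧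
    ∀ t ∈ Set.Icc a b, m • deriv (deriv f) t = -gradient V (f t)

/-- The set of `C²` solutions of `m γ'' = −∇V(γ)` starting in `Ka` and ending in `Kb`,
viewed as a subset of the path space. -/
def NewtonSet {n : ℕ} (m : ℝ) (V : Eu n → ℝ) (a b : ℝ) (Ka Kb : Set (Eu n)) :
    Set (CPath a b n) :=
  {γ | ∃ f : ℝ → Eu n, ContDiff ℝ 2 f ∧ (∀ t : Set.Icc a b, γ t = f t) ∧
    (∀ t ∈ Set.Icc a b, m • deriv (deriv f) t = -gradient V (f t)) ∧
    f a ∈ Ka ∧ f b ∈ Kb}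

/-- `γ` is piecewise affine subordinate to the partition `a = τ₀ < … < τ_l = b`. -/
def PiecewiseAffine {n : ℕ} (a b : ℝ) (τ : ℕ → ℝ) (l : ℕ) (γ : CPath a b n) : Prop :=
  ∀ j < l, ∀ t : Set.Icc a b, (t : ℝ) ∈ Set.Icc (τ j) (τ (j + 1)) →
    γ t = pev γ (τ j) + (((t : ℝ) - τ j) / (τ (j + 1) - τ j)) •
      (pev γ (τ (j + 1)) - pev γ (τ j))

/-- `IsPartition a b τ l h`: `a = τ₀ < τ₁ < … < τ_l = b` is a partition of `[a,b]` of mesh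
at most `h`. -/
def IsPartition (a b : ℝ) (τ : ℕ → ℝ) (l : ℕ) (h : ℝ) : Prop :=
  1 ≤ l ∧ τ 0 = a ∧ τ l = b ∧ (∀ j < l, τ j < τ (j + 1)) ∧
    ∀ j < l, τ (j + 1) - τ j ≤ h

/-- The midpoint-rule discrete action, as a (real-valued) sum over the first `l` intervals
of the partition. -/
def dActionSum {n : ℕ} (m : ℝ) (V : Eu n → ℝ) {a b : ℝ} (τ : ℕ → ℝ) (l : ℕ)
    (γ : CPath a b n) : ℝ :=
  ∑ j ∈ Finset.range l,
    (m / 2 * ‖pev γ (τ (j + 1)) - pev γ (τ j)‖ ^ 2 / (τ (j + 1) - τ j) -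
      V ((2 : ℝ)⁻¹ • (pev γ (τ (j + 1)) + pev γ (τ j))) * (τ (j + 1) - τ j))

open Classical in
/-- The discrete action `𝒜^{[h]}`: the midpoint-rule discrete action for piecewise affine
curves subordinate to the partition, `+∞` otherwise. -/
def dAction {n : ℕ} (m : ℝ) (V : Eu n → ℝ) (a b : ℝ) (τ : ℕ → ℝ) (l : ℕ)
    (γ : CPath a b n) : EReal :=
  if PiecewiseAffine a b τ l γ then ((dActionSum m V τ l γ : ℝ) : EReal) else ⊤

/-- The discrete Euler–Lagrange equations for a piecewise affine curve subordinate to the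
partition `a = τ₀ < … < τ_l = b`. -/
def DiscreteEL {n : ℕ} (m : ℝ) (V : Eu n → ℝ) {a b : ℝ} (τ : ℕ → ℝ) (l : ℕ)
    (γ : CPath a b n) : Prop :=
  ∀ j, 1 ≤ j → j < l →
    m • ((τ j - τ (j - 1))⁻¹ • (pev γ (τ j) - pev γ (τ (j - 1)))) -
      m • ((τ (j + 1) - τ j)⁻¹ • (pev γ (τ (j + 1)) - pev γ (τ j))) =
    ((τ j - τ (j - 1)) / 2) • gradient V ((2 : ℝ)⁻¹ • (pev γ (τ (j - 1)) + pev γ (τ j))) +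
      ((τ (j + 1) - τ j) / 2) • gradient V ((2 : ℝ)⁻¹ • (pev γ (τ j) + pev γ (τ (j + 1))))

end

section Velocity

variable {a b : ℝ} {n : ℕ}

/-- `g` is a velocity of the curve `γ`: it is integrable on `[a,b]` and `γ` is its primitive. -/
def IsVelocity (γ : CPath a b n) (g : ℝ → Eu n) : Prop :=
  IntegrableOn g (Set.Icc a b) ∧ ∀ s t : Set.Icc a b, γ t = γ s + ∫ u in (s : ℝ)..(t : ℝ), g u

lemma pev_of_mem (γ : CPath a b n) {t : ℝ} (ht : t ∈ Set.Icc a b) : pev γ t = γ ⟨t, ht⟩ :=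
  dif_pos ht

lemma continuousOn_pev (γ : CPath a b n) : ContinuousOn (pev γ) (Set.Icc a b) := by
  rw [continuousOn_iff_continuous_domRestrict]
  convert γ.continuous using 1
  ext1 t
  exact pev_of_mem γ t.2

lemma IsVelocity.intervalIntegrable {γ : CPath a b n} {g : ℝ → Eu n} (h : IsVelocity γ g)
    {s t : ℝ} (hs : s ∈ Set.Icc a b) (ht : t ∈ Set.Icc a b) : IntervalIntegrable g volume s t :=
  (h.1.mono_set (Set.uIcc_subset_Icc hs ht)).intervalIntegrable

lemma IsVelocity.pev_eq {γ : CPath a b n} {g : ℝ → Eu n} (h : IsVelocity γ g)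
    {s t : ℝ} (hs : s ∈ Set.Icc a b) (ht : t ∈ Set.Icc a b) :
    pev γ t = pev γ s + ∫ u in s..t, g u := by
  rw [pev_of_mem γ hs, pev_of_mem γ ht]
  exact h.2 ⟨s, hs⟩ ⟨t, ht⟩

lemma IsVelocity.congr {γ : CPath a b n} {g g' : ℝ → Eu n} (h : IsVelocity γ g)
    (hg : g =ᵐ[volume.restrict (Set.Icc a b)] g') : IsVelocity γ g' := by
  refine ⟨h.1.congr hg, fun s t => ?_⟩
  rw [h.2 s t]
  congr 1
  refine intervalIntegral.integral_congr_ae ?_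
  rw [EventuallyEq, ae_restrict_iff' measurableSet_Icc] at hg
  filter_upwards [hg] with x hx hxs
  exact hx (Set.uIcc_subset_Icc s.2 t.2 (Set.uIoc_subset_uIcc hxs))

/-- Two velocities of the same curve agree almost everywhere. -/
lemma IsVelocity.ae_eq {γ : CPath a b n} {g g' : ℝ → Eu n} (h : IsVelocity γ g)
    (h' : IsVelocity γ g') : g =ᵐ[volume.restrict (Set.Icc a b)] g' := by
  rcases le_or_gt a b with hab | hab
  · have ha : a ∈ Set.Icc a b := Set.left_mem_Icc.2 hab
    have hb : b ∈ Set.Icc a b := Set.right_mem_Icc.2 hab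
    rw [EventuallyEq, ← restrict_Ioo_eq_restrict_Icc, ae_restrict_iff' measurableSet_Ioo]
    filter_upwards [(h.intervalIntegrable ha hb).ae_hasDerivAt_integral,
      (h'.intervalIntegrable ha hb).ae_hasDerivAt_integral] with t h1 h2 ht
    have hu : Set.uIcc a b = Set.Icc a b := Set.uIcc_of_le hab
    have d1 := h1 (hu ▸ Set.Ioo_subset_Icc_self ht) a (hu ▸ ha)
    have d2 := h2 (hu ▸ Set.Ioo_subset_Icc_self ht) a (hu ▸ ha)
    refine d1.unique (d2.congr_of_eventuallyEq ?_)
    filter_upwards [Ioo_mem_nhds ht.1 ht.2] with x hx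
    have hx' := Set.Ioo_subset_Icc_self hx
    exact add_left_cancel ((h.pev_eq ha hx').symm.trans (h'.pev_eq ha hx'))
  · simp [Set.Icc_eq_empty hab.not_ge, EventuallyEq]

lemma IsVelocity.isACC {γ : CPath a b n} {g : ℝ → Eu n} (h : IsVelocity γ g) : IsACC γ := ⟨g, h⟩

/-- The action is computed by any velocity of the curve. -/
lemma IsVelocity.action_le_coe_iff {γ : CPath a b n} {g : ℝ → Eu n} (h : IsVelocity γ g)
    (L : Eu n → Eu n → ℝ) (α : ℝ) :
    action L a b γ ≤ α ↔ IntegrableOn (fun t => L (pev γ t) (g t)) (Set.Icc a b) ∧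
      ∫ t in Set.Icc a b, L (pev γ t) (g t) ≤ α := by
  have hae : (fun t => L (pev γ t) (h.isACC.choose t)) =ᵐ[volume.restrict (Set.Icc a b)]
      fun t => L (pev γ t) (g t) := by
    have : IsVelocity γ h.isACC.choose := h.isACC.choose_spec
    filter_upwards [this.ae_eq h] with t ht
    rw [ht]
  rw [action, dif_pos h.isACC, IntegrableOn, IntegrableOn, integrable_congr hae,
    integral_congr_ae hae]
  split_ifs with hi
  · simp [hi]
  · simp [hi]

/-- A velocity can be chosen strongly measurable. -/
lemma IsACC.exists_stronglyMeasurable {γ : CPath a b n} (h : IsACC γ) :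
    ∃ g : ℝ → Eu n, StronglyMeasurable g ∧ IsVelocity γ g := by
  obtain ⟨g, hg⟩ := h
  have hg : IsVelocity γ g := hg
  exact ⟨_, hg.1.aestronglyMeasurable.stronglyMeasurable_mk,
    hg.congr hg.1.aestronglyMeasurable.ae_eq_mk⟩

end Velocity

/-- The gradient inequality for a uniformly convex function. -/
lemma add_fderiv_add_le_of_le_fderiv_fderiv {E : Type*} [NormedAddCommGroup E] [NormedSpace ℝ E]
    {f : E → ℝ} (hf : ContDiff ℝ 2 f) {c : ℝ}
    (hc : ∀ v w : E, c * ‖w‖ ^ 2 ≤ fderiv ℝ (fderiv ℝ f) v w w) (v u : E) :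
    f v + fderiv ℝ f v (u - v) + c / 2 * ‖u - v‖ ^ 2 ≤ f u := by
  have hf1 : Differentiable ℝ f := hf.differentiable (by norm_num)
  have hf2 : Differentiable ℝ (fderiv ℝ f) :=
    (hf.fderiv_right (m := 1) (by norm_num)).differentiable (by norm_num)
  set w := u - v with hw
  have hl (t : ℝ) : HasDerivAt (fun t : ℝ => v + t • w) w t := by
    simpa using ((hasDerivAt_id t).smul_const w).const_add v
  have h1 (t : ℝ) : HasDerivAt (fun t : ℝ => f (v + t • w) - c / 2 * ‖w‖ ^ 2 * t ^ 2)
      (fderiv ℝ f (v + t • w) w - c * ‖w‖ ^ 2 * t) t := by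
    refine ((hf1 _).hasFDerivAt.comp_hasDerivAt t (hl t)).sub ?_
    refine ((hasDerivAt_pow 2 t).const_mul (c / 2 * ‖w‖ ^ 2)).congr_deriv ?_
    norm_num
    ring
  have h2 (t : ℝ) : HasDerivAt (fun t : ℝ => fderiv ℝ f (v + t • w) w - c * ‖w‖ ^ 2 * t)
      (fderiv ℝ (fderiv ℝ f) (v + t • w) w w - c * ‖w‖ ^ 2) t := by
    refine HasDerivAt.sub ?_ (by simpa using (hasDerivAt_id t).const_mul (c * ‖w‖ ^ 2))
    have : HasDerivAt (fun t : ℝ => fderiv ℝ f (v + t • w))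
        (fderiv ℝ (fderiv ℝ f) (v + t • w) w) t :=
      (hf2 (v + t • w)).hasFDerivAt.comp_hasDerivAt t (hl t)
    simpa using this.clm_apply (hasDerivAt_const t w)
  have hconv : ConvexOn ℝ Set.univ (fun t : ℝ => f (v + t • w) - c / 2 * ‖w‖ ^ 2 * t ^ 2) := by
    refine Monotone.convexOn_univ_of_deriv (fun t => (h1 t).differentiableAt) ?_
    rw [funext fun t => (h1 t).deriv]
    exact monotone_of_deriv_nonneg (fun t => (h2 t).differentiableAt)
      fun t => by rw [(h2 t).deriv]; linarith [hc (v + t • w) w]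
  have := hconv.le_slope_of_hasDerivAt (Set.mem_univ 0) (Set.mem_univ 1) one_pos (h1 0)
  simp [slope_def_field, hw] at this
  rw [hw, map_sub]
  linarith

/-- A primitive of a density with values in `[1/2, 1]` is a homeomorphism of the line which
transports the weighted Lebesgue measure to the Lebesgue measure. -/
lemma exists_homeomorph_measurePreserving {ρ : ℝ → ℝ≥0} (hρ : Measurable ρ)
    (h1 : ∀ t, 1 / 2 ≤ ρ t) (h2 : ∀ t, ρ t ≤ 1) (a c : ℝ) :
    ∃ e : ℝ ≃ₜ ℝ, StrictMono e ∧ (∀ t, e t = a + ∫ u in c..t, (ρ u : ℝ)) ∧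
      MeasurePreserving e (volume.withDensity fun t => (ρ t : ℝ≥0∞)) volume := by
  have hb1 (t : ℝ) : (1 / 2 : ℝ) ≤ ρ t := by exact_mod_cast h1 t
  have hb2 (t : ℝ) : (ρ t : ℝ) ≤ 1 := by exact_mod_cast h2 t
  have hm : Measurable fun t => (ρ t : ℝ) := hρ.coe_nnreal_real
  have hi (s t : ℝ) : IntervalIntegrable (fun t => (ρ t : ℝ)) volume s t :=
    (intervalIntegrable_const (c := (1 : ℝ))).mono_fun hm.aestronglyMeasurable
      (ae_of_all _ fun t => by simpa using hb2 t)
  set σ : ℝ → ℝ := fun t => a + ∫ u in c..t, (ρ u : ℝ) with hσ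
  have hdiff (s t : ℝ) : σ t - σ s = ∫ u in s..t, (ρ u : ℝ) := by
    simp only [hσ]
    rw [add_sub_add_left_eq_sub, intervalIntegral.integral_interval_sub_left (hi _ _) (hi _ _)]
  have hlow {s t : ℝ} (hst : s ≤ t) : (t - s) / 2 ≤ σ t - σ s := by
    rw [hdiff]
    have := intervalIntegral.integral_mono hst (intervalIntegrable_const (c := (1 / 2 : ℝ)))
      (hi s t) hb1
    simp only [intervalIntegral.integral_const, smul_eq_mul] at this
    linarith
  have hmono : StrictMono σ := fun s t hst => by linarith [hlow hst.le]
  have hcont : Continuous σ :=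
    continuous_const.add (intervalIntegral.continuous_primitive hi c)
  have htop : Tendsto σ atTop atTop := by
    refine tendsto_atTop_mono' atTop ?_
      ((tendsto_id.atTop_mul_const (by norm_num : (0 : ℝ) < 1 / 2)).atTop_add
        (tendsto_const_nhds (x := σ 0)))
    filter_upwards [eventually_ge_atTop 0] with t ht
    simp only [id]
    linarith [hlow ht]
  have hbot : Tendsto σ atBot atBot := by
    refine tendsto_atBot_mono' atBot ?_
      ((tendsto_id.atBot_mul_const (by norm_num : (0 : ℝ) < 1 / 2)).atBot_add
        (tendsto_const_nhds (x := σ 0)))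
    filter_upwards [eventually_le_atBot 0] with t ht
    simp only [id]
    linarith [hlow ht]
  have hsurj : Function.Surjective σ := hcont.surjective htop hbot
  let e : ℝ ≃ₜ ℝ := (hmono.orderIsoOfSurjective σ hsurj).toHomeomorph
  have he (t : ℝ) : e t = σ t := rfl
  refine ⟨e, hmono, he, e.measurable, ?_⟩
  have hIoo (x y : ℝ) : (volume.withDensity fun t => (ρ t : ℝ≥0∞)).map e (Set.Ioo x y) =
      volume (Set.Ioo x y) := by
    rcases le_or_gt y x with hxy | hxy
    · simp [Set.Ioo_eq_empty hxy.not_gt]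
    obtain ⟨s, rfl⟩ := hsurj x
    obtain ⟨t, rfl⟩ := hsurj y
    have hst : s < t := hmono.lt_iff_lt.1 hxy
    have hpre : e ⁻¹' Set.Ioo (σ s) (σ t) = Set.Ioo s t := by
      ext u
      simp [he, hmono.lt_iff_lt]
    rw [Measure.map_apply e.measurable measurableSet_Ioo, hpre,
      withDensity_apply _ measurableSet_Ioo, Real.volume_Ioo, hdiff,
      intervalIntegral.integral_of_le hst.le, integral_Ioc_eq_integral_Ioo,
      ofReal_integral_eq_lintegral_ofReal
        (((hi s t).1).mono_set Set.Ioo_subset_Ioc_self) (ae_of_all _ fun t => (ρ t).2)]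
    simp
  have : IsLocallyFiniteMeasure
      ((volume.withDensity fun t => (ρ t : ℝ≥0∞)).map e) :=
    ⟨fun x => ⟨Set.Ioo (x - 1) (x + 1), Ioo_mem_nhds (by linarith) (by linarith), by
      rw [hIoo]; exact measure_Ioo_lt_top⟩⟩
  exact Real.measure_ext_Ioo_rat fun x y => hIoo x y

/-- Time change of an absolutely continuous curve. -/
lemma exists_isVelocity_timeChange {n : ℕ} {a b c d : ℝ} (hab : a ≤ b)
    {G : ℝ → Eu n} (hG : Integrable G) {ρ : ℝ → ℝ≥0} (hρ : Measurable ρ)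
    (h1 : ∀ t, 1 / 2 ≤ ρ t) (h2 : ∀ t, ρ t ≤ 1) (hlen : ∫ t in c..d, (ρ t : ℝ) = b - a)
    (p : Eu n) :
    ∃ (γ : CPath a b n) (g : ℝ → Eu n), IsVelocity γ g ∧ pev γ a = p ∧
      pev γ b = p + ∫ u in c..d, G u ∧ ∀ F : Eu n → Eu n → ℝ,
      IntegrableOn (fun t => (ρ t : ℝ) * F (p + ∫ u in c..t, G u) ((ρ t)⁻¹ • G t))
        (Set.Icc c d) →
      IntegrableOn (fun t => F (pev γ t) (g t)) (Set.Icc a b) ∧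
      ∫ t in Set.Icc a b, F (pev γ t) (g t) =
        ∫ t in Set.Icc c d, (ρ t : ℝ) * F (p + ∫ u in c..t, G u) ((ρ t)⁻¹ • G t) := by
  obtain ⟨e, hmono, he, hmp⟩ := exists_homeomorph_measurePreserving hρ h1 h2 a c
  have hme : MeasurableEmbedding e := e.measurableEmbedding
  have hρ0 (t : ℝ) : ρ t ≠ 0 := fun h => by simpa [h] using h1 t
  have hec : e c = a := by simp [he]
  have hed : e d = b := by rw [he, hlen]; ring
  have hpre (s t : ℝ) : e ⁻¹' Set.Icc (e s) (e t) = Set.Icc s t := by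
    ext u; simp [hmono.le_iff_le]
  have hpre' (s t : ℝ) : e ⁻¹' Set.Ioc (e s) (e t) = Set.Ioc s t := by
    ext u; simp [hmono.le_iff_le, hmono.lt_iff_lt]
  have hIcc : e ⁻¹' Set.Icc a b = Set.Icc c d := by rw [← hpre c d, hec, hed]
  let Γ : ℝ → Eu n := fun t => p + ∫ u in c..t, G u
  have hΓ : Continuous Γ :=
    continuous_const.add (intervalIntegral.continuous_primitive (fun _ _ => hG.intervalIntegrable) c)
  let g : ℝ → Eu n := fun s => (ρ (e.symm s))⁻¹ • G (e.symm s)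
  have hge (t : ℝ) : g (e t) = (ρ t)⁻¹ • G t := by simp [g]
  have hsm (t : ℝ) : ρ t • g (e t) = G t := by rw [hge, smul_inv_smul₀ (hρ0 t)]
  let γ : CPath a b n := ⟨fun s => Γ (e.symm s), by fun_prop⟩
  have hpev {s : ℝ} (hs : s ∈ Set.Icc a b) : pev γ s = Γ (e.symm s) := pev_of_mem γ hs
  have hint (E : Type) [NormedAddCommGroup E] [NormedSpace ℝ E] (f : ℝ → E) (s : Set ℝ)
      (hs : MeasurableSet s) :
      IntegrableOn f s ↔ IntegrableOn (fun t => ρ t • f (e t)) (e ⁻¹' s) := by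
    rw [← hmp.integrableOn_comp_preimage hme, IntegrableOn,
      restrict_withDensity (e.measurable hs), integrable_withDensity_iff_integrable_smul hρ]
    rfl
  have hintegral (E : Type) [NormedAddCommGroup E] [NormedSpace ℝ E] (f : ℝ → E) (s : Set ℝ)
      (hs : MeasurableSet s) :
      ∫ x in s, f x = ∫ t in e ⁻¹' s, ρ t • f (e t) := by
    rw [← hmp.setIntegral_preimage_emb hme,
      setIntegral_withDensity_eq_setIntegral_smul hρ _ (e.measurable hs)]
  have hg : Integrable g := by
    rw [← integrableOn_univ, hint _ _ _ MeasurableSet.univ]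
    simpa [hsm] using hG
  have horder {s t : ℝ} (hst : s ≤ t) : e.symm s ≤ e.symm t := by
    rwa [← hmono.le_iff_le, e.apply_symm_apply, e.apply_symm_apply]
  refine ⟨γ, g, ⟨hg.integrableOn, ?_⟩, ?_, ?_, ?_⟩
  · suffices key : ∀ s t : ℝ, s ≤ t → Γ t = Γ s + ∫ u in (e s)..(e t), g u by
      rintro ⟨s, hs⟩ ⟨t, ht⟩
      change Γ (e.symm t) = Γ (e.symm s) + ∫ u in s..t, g u
      rcases le_total s t with hst | hst
      · simpa using key _ _ (horder hst)
      · rw [intervalIntegral.integral_symm, ← sub_eq_add_neg, eq_sub_iff_add_eq]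
        simpa using (key _ _ (horder hst)).symm
    intro s t hst
    rw [intervalIntegral.integral_of_le (hmono.monotone hst), hintegral _ _ _ measurableSet_Ioc, hpre']
    simp only [hsm]
    rw [← intervalIntegral.integral_of_le hst]
    simp only [Γ]
    rw [add_assoc, intervalIntegral.integral_add_adjacent_intervals hG.intervalIntegrable
      hG.intervalIntegrable]
  · rw [hpev (Set.left_mem_Icc.2 hab), ← hec]
    simp [Γ]
  · rw [hpev (Set.right_mem_Icc.2 hab), ← hed]
    simp [Γ]
  · intro F hF
    have hcongr : ∀ t ∈ Set.Icc c d, ρ t • F (pev γ (e t)) (g (e t)) =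
        (ρ t : ℝ) * F (p + ∫ u in c..t, G u) ((ρ t)⁻¹ • G t) := by
      intro t ht
      rw [← hIcc] at ht
      rw [hge, hpev ht, e.symm_apply_apply]
      rfl
    refine ⟨?_, ?_⟩
    · rw [hint _ _ _ measurableSet_Icc, hIcc]
      exact hF.congr_fun (fun t ht => (hcongr t ht).symm) measurableSet_Icc
    · rw [hintegral _ _ _ measurableSet_Icc, hIcc]
      exact setIntegral_congr_fun measurableSet_Icc hcongr

/-- A continuous function of two variables is bounded on products of compact sets. -/
lemma exists_bound_of_isCompact {E F : Type*} [TopologicalSpace E] [TopologicalSpace F]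
    {L : E → F → ℝ} (hL : Continuous (Function.uncurry L)) {K : Set E} {K' : Set F}
    (hK : IsCompact K) (hK' : IsCompact K') :
    ∃ B : ℝ, 0 ≤ B ∧ ∀ x ∈ K, ∀ v ∈ K', |L x v| ≤ B := by
  obtain ⟨B, hB⟩ := (hK.prod hK').exists_bound_of_continuousOn hL.continuousOn
  exact ⟨max B 0, le_max_right _ _, fun x hx v hv => (hB (x, v) ⟨hx, hv⟩).trans (le_max_left _ _)⟩

lemma aestronglyMeasurable_comp_pev {a b : ℝ} {n : ℕ} {X : Type*} [TopologicalSpace X]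
    [TopologicalSpace.PseudoMetrizableSpace X] {L : Eu n → Eu n → X}
    (hL : Continuous (Function.uncurry L)) (γ : CPath a b n) {g : ℝ → Eu n} {E : Set ℝ}
    (hE : E ⊆ Set.Icc a b) (hg : AEStronglyMeasurable g (volume.restrict (Set.Icc a b))) :
    AEStronglyMeasurable (fun t => L (pev γ t) (g t)) (volume.restrict E) :=
  hL.comp_aestronglyMeasurable
    ((((continuousOn_pev γ).aestronglyMeasurable measurableSet_Icc).prodMk hg).mono_measure
      (Measure.restrict_mono_set _ hE))

lemma isCompact_pev_image {a b : ℝ} {n : ℕ} (γ : CPath a b n) :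
    IsCompact (pev γ '' Set.Icc a b) :=
  isCompact_Icc.image_of_continuousOn (continuousOn_pev γ)

/-- Slightly speeding up a curve on a set where its velocity is bounded changes the action
only a little. -/
lemma tendsto_integral_speedup {a b : ℝ} {n : ℕ} {L : Eu n → Eu n → ℝ}
    (hL : Continuous (Function.uncurry L)) (γ : CPath a b n) {g : ℝ → Eu n}
    (hg : StronglyMeasurable g) {E : Set ℝ} (hE : MeasurableSet E)
    (hEab : E ⊆ Set.Icc a b) {R : ℝ} (hR : ∀ t ∈ E, ‖g t‖ ≤ R) :
    (∀ θ ∈ Set.Icc (0 : ℝ) (1 / 2),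
      IntegrableOn (fun t => (1 - θ) * L (pev γ t) ((1 - θ)⁻¹ • g t)) E) ∧
    Tendsto (fun θ : ℝ => ∫ t in E, (1 - θ) * L (pev γ t) ((1 - θ)⁻¹ • g t)) (𝓝[>] 0)
      (𝓝 (∫ t in E, L (pev γ t) (g t))) := by
  obtain ⟨B, hB0, hB⟩ := exists_bound_of_isCompact hL (isCompact_pev_image γ)
    (isCompact_closedBall (0 : Eu n) (2 * R))
  have hEfin : volume E ≠ ∞ := ((measure_mono hEab).trans_lt measure_Icc_lt_top).ne
  have hm (θ : ℝ) : AEStronglyMeasurable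
      (fun t => (1 - θ) * L (pev γ t) ((1 - θ)⁻¹ • g t)) (volume.restrict E) :=
    (aestronglyMeasurable_comp_pev hL γ hEab
      (hg.const_smul ((1 - θ)⁻¹)).aestronglyMeasurable).const_mul _
  have hbound (θ : ℝ) (hθ : θ ∈ Set.Icc (0 : ℝ) (1 / 2)) (t : ℝ) (ht : t ∈ E) :
      ‖(1 - θ) * L (pev γ t) ((1 - θ)⁻¹ • g t)‖ ≤ B := by
    have h0 : (0 : ℝ) < 1 - θ := by linarith [hθ.2]
    have hinv : (1 - θ)⁻¹ ≤ 2 := by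
      rw [inv_le_comm₀ h0 two_pos]
      linarith [hθ.2]
    have h1 : |L (pev γ t) ((1 - θ)⁻¹ • g t)| ≤ B := by
      refine hB _ ⟨t, hEab ht, rfl⟩ _ ?_
      rw [mem_closedBall_zero_iff, norm_smul, Real.norm_of_nonneg (inv_nonneg.2 h0.le)]
      exact mul_le_mul hinv (hR t ht) (norm_nonneg _) two_pos.le
    rw [norm_mul, Real.norm_of_nonneg h0.le, Real.norm_eq_abs]
    nlinarith [hθ.1, abs_nonneg (L (pev γ t) ((1 - θ)⁻¹ • g t))]
  refine ⟨fun θ hθ => ?_, ?_⟩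
  · exact IntegrableOn.of_bound hEfin.lt_top (hm θ) B
      ((ae_restrict_iff' hE).2 (ae_of_all _ (hbound θ hθ)))
  · refine tendsto_integral_filter_of_dominated_convergence (fun _ => B)
      (Eventually.of_forall hm) ?_ (integrableOn_const hEfin) ?_
    · filter_upwards [Ioo_mem_nhdsGT (show (0 : ℝ) < 1 / 2 by norm_num)] with θ hθ
      exact (ae_restrict_iff' hE).2 (ae_of_all _ (hbound θ ⟨hθ.1.le, hθ.2.le⟩))
    · refine ae_of_all _ fun t => ?_
      have hc : ContinuousAt (fun θ : ℝ => (1 - θ) * L (pev γ t) ((1 - θ)⁻¹ • g t)) 0 := by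
        have h1 : ContinuousAt (fun θ : ℝ => (pev γ t, (1 - θ)⁻¹ • g t)) 0 := by
          have hinv : ContinuousAt (fun θ : ℝ => (1 - θ)⁻¹) 0 :=
            ContinuousAt.inv₀ (by fun_prop) (by norm_num)
          exact continuousAt_const.prodMk (hinv.smul continuousAt_const)
        have h2 : ContinuousAt (fun θ : ℝ => 1 - θ) 0 := by fun_prop
        exact h2.mul (hL.continuousAt.comp h1)
      have := hc.tendsto.mono_left (nhdsWithin_le_nhds (s := Set.Ioi 0))
      simpa using this

/-- A measurable function is bounded on a set of positive measure. -/
lemma exists_pos_measure_norm_le {n : ℕ} {a b : ℝ} (hab : a < b) (g : ℝ → Eu n) :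
    ∃ R : ℝ, 0 < volume (Set.Ioc a b ∩ {t | ‖g t‖ ≤ R}) := by
  by_contra! h
  have h0 : volume (⋃ k : ℕ, Set.Ioc a b ∩ {t | ‖g t‖ ≤ k}) = 0 :=
    measure_iUnion_null fun k => le_antisymm (h k) zero_le
  have : (⋃ k : ℕ, Set.Ioc a b ∩ {t | ‖g t‖ ≤ k}) = Set.Ioc a b := by
    rw [← Set.inter_iUnion, Set.inter_eq_left]
    intro t _
    exact Set.mem_iUnion.2 (exists_nat_ge ‖g t‖)
  rw [this, Real.volume_Ioc] at h0
  simp at h0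
  linarith

lemma integrableOn_Ioc_and_setIntegral_le {Φ h : ℝ → ℝ} {s t B : ℝ} (hst : s ≤ t)
    (hh : Continuous h) (heq : Set.EqOn h Φ (Set.Ioc s t)) (hB : ∀ x ∈ Set.Ioc s t, h x ≤ B) :
    IntegrableOn Φ (Set.Ioc s t) ∧ ∫ x in Set.Ioc s t, Φ x ≤ (t - s) * B := by
  have hi : IntegrableOn h (Set.Ioc s t) := (hh.integrableOn_Icc).mono_set Set.Ioc_subset_Icc_self
  refine ⟨hi.congr_fun heq measurableSet_Ioc, ?_⟩
  rw [← setIntegral_congr_fun measurableSet_Ioc heq]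
  refine (setIntegral_mono_on hi (integrableOn_const (by simp)) measurableSet_Ioc hB).trans ?_
  simp [hst]

/-- Every curve of finite action can be approximated in action by curves with prescribed nearby
endpoints: time is saved by speeding up where the velocity is bounded, and spent on short
segments at both ends. -/
lemma exists_competitor {a b : ℝ} (hab : a < b) {n : ℕ} {L : Eu n → Eu n → ℝ}
    (hL : Continuous (Function.uncurry L)) (γ' : CPath a b n) (hγ' : IsACC γ') {A ε : ℝ}
    (hA : action L a b γ' ≤ A) (hε : 0 < ε) :
    ∃ η > 0, ∀ x y : Eu n, ‖pev γ' a - x‖ ≤ η → ‖y - pev γ' b‖ ≤ η →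
      ∃ γ : CPath a b n, IsACC γ ∧ pev γ a = x ∧ pev γ b = y ∧ action L a b γ ≤ ((A + ε : ℝ) : EReal) := by
  obtain ⟨g, hgm, hg⟩ := hγ'.exists_stronglyMeasurable
  rw [hg.action_le_coe_iff] at hA
  obtain ⟨R, hR⟩ := exists_pos_measure_norm_le hab g
  set E : Set ℝ := Set.Ioc a b ∩ {t | ‖g t‖ ≤ R} with hEdef
  have hE : MeasurableSet E :=
    measurableSet_Ioc.inter (measurableSet_le hgm.norm.measurable measurable_const)
  have hEab : E ⊆ Set.Ioc a b := Set.inter_subset_left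
  have hEfin : volume E ≠ ∞ := ((measure_mono hEab).trans_lt measure_Ioc_lt_top).ne
  set m : ℝ := volume.real E with hm
  have hm0 : 0 < m := ENNReal.toReal_pos hR.ne' hEfin
  obtain ⟨hsi, hst⟩ := tendsto_integral_speedup hL γ' hgm hE
    (hEab.trans Set.Ioc_subset_Icc_self) (R := R) fun t ht => ht.2
  obtain ⟨B, hB0, hB⟩ := exists_bound_of_isCompact hL
    ((isCompact_closedBall (pev γ' a) 1).union (isCompact_closedBall (pev γ' b) 1))
    (isCompact_closedBall (0 : Eu n) 1)
  obtain ⟨θ, hθ0, hθ2, hθE, hθm, hθB⟩ : ∃ θ : ℝ, 0 < θ ∧ θ < 1 / 2 ∧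
      ∫ t in E, (1 - θ) * L (pev γ' t) ((1 - θ)⁻¹ • g t) <
        (∫ t in E, L (pev γ' t) (g t)) + ε / 2 ∧ θ * m / 2 < 1 ∧ θ * m * B < ε / 2 := by
    have c1 : Tendsto (fun θ : ℝ => θ * m / 2) (𝓝[>] 0) (𝓝 0) :=
      tendsto_nhdsWithin_of_tendsto_nhds (by simpa using
        (show Continuous fun θ : ℝ => θ * m / 2 by fun_prop).tendsto 0)
    have c2 : Tendsto (fun θ : ℝ => θ * m * B) (𝓝[>] 0) (𝓝 0) :=
      tendsto_nhdsWithin_of_tendsto_nhds (by simpa using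
        (show Continuous fun θ : ℝ => θ * m * B by fun_prop).tendsto 0)
    have c0 : ∀ᶠ θ in 𝓝[>] (0 : ℝ), θ ∈ Set.Ioo (0 : ℝ) (1 / 2) :=
      Ioo_mem_nhdsGT (by norm_num)
    obtain ⟨θ, h1, h2, h3, h4⟩ := (c0.and
      ((hst.eventually_lt_const (lt_add_of_pos_right _ (half_pos hε))).and
      ((c1.eventually_lt_const one_pos).and
        (c2.eventually_lt_const (half_pos hε))))).exists
    exact ⟨θ, h1.1, h1.2, h2, h3, h4⟩
  set δ : ℝ := θ * m / 2 with hδ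
  have hδ0 : 0 < δ := by positivity
  refine ⟨δ, hδ0, fun x y hx hy => ?_⟩
  set u : Eu n := δ⁻¹ • (pev γ' a - x) with hu
  set w : Eu n := δ⁻¹ • (y - pev γ' b) with hw
  have hu' : δ • u = pev γ' a - x := smul_inv_smul₀ hδ0.ne' _
  have hw' : δ • w = y - pev γ' b := smul_inv_smul₀ hδ0.ne' _
  have hu1 : ‖u‖ ≤ 1 := by
    rw [hu, norm_smul, norm_inv, Real.norm_of_nonneg hδ0.le, inv_mul_le_one₀ hδ0]
    exact hx
  have hw1 : ‖w‖ ≤ 1 := by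
    rw [hw, norm_smul, norm_inv, Real.norm_of_nonneg hδ0.le, inv_mul_le_one₀ hδ0]
    exact hy
  have haδ : a - δ ≤ a := by linarith
  have hbδ : b ≤ b + δ := by linarith
  let G : ℝ → Eu n := (Set.Ioc (a - δ) a).indicator (fun _ => u) + (Set.Ioc a b).indicator g +
    (Set.Ioc b (b + δ)).indicator (fun _ => w)
  have hG : Integrable G := by
    refine (Integrable.add ?_ ?_).add ?_
    · exact (integrable_indicator_iff measurableSet_Ioc).2 (integrableOn_const (by simp))
    · exact (integrable_indicator_iff measurableSet_Ioc).2
        (hg.1.mono_set Set.Ioc_subset_Icc_self)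
    · exact (integrable_indicator_iff measurableSet_Ioc).2 (integrableOn_const (by simp))
  have hG1 : ∀ t ∈ Set.Ioc (a - δ) a, G t = u := by
    intro t ht
    have h2 : t ∉ Set.Ioc a b := fun h => absurd h.1 (not_lt.2 ht.2)
    have h3 : t ∉ Set.Ioc b (b + δ) := fun h => by linarith [h.1, ht.2]
    simp [G, Set.indicator_of_mem ht, Set.indicator_of_notMem h2, Set.indicator_of_notMem h3]
  have hG2 : ∀ t ∈ Set.Ioc a b, G t = g t := by
    intro t ht
    have h2 : t ∉ Set.Ioc (a - δ) a := fun h => absurd ht.1 (not_lt.2 h.2)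
    have h3 : t ∉ Set.Ioc b (b + δ) := fun h => by linarith [h.1, ht.2]
    simp [G, Set.indicator_of_mem ht, Set.indicator_of_notMem h2, Set.indicator_of_notMem h3]
  have hG3 : ∀ t ∈ Set.Ioc b (b + δ), G t = w := by
    intro t ht
    have h2 : t ∉ Set.Ioc (a - δ) a := fun h => by linarith [h.2, ht.1]
    have h3 : t ∉ Set.Ioc a b := fun h => absurd ht.1 (not_lt.2 h.2)
    simp [G, Set.indicator_of_mem ht, Set.indicator_of_notMem h2, Set.indicator_of_notMem h3]
  have hGi (s t : ℝ) : IntervalIntegrable G volume s t := hG.intervalIntegrable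
  have hcongr {s t : ℝ} {f : ℝ → Eu n} (hst : s ≤ t) (h : ∀ r ∈ Set.Ioc s t, G r = f r) :
      ∫ r in s..t, G r = ∫ r in s..t, f r := by
    rw [intervalIntegral.integral_of_le hst, intervalIntegral.integral_of_le hst]
    exact setIntegral_congr_fun measurableSet_Ioc h
  let Γ : ℝ → Eu n := fun t => x + ∫ r in (a - δ)..t, G r
  have hΓadd (s t : ℝ) : Γ t = Γ s + ∫ r in s..t, G r := by
    simp only [Γ]
    rw [add_assoc, intervalIntegral.integral_add_adjacent_intervals (hGi _ _) (hGi _ _)]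
  have hΓ1 : ∀ t ∈ Set.Icc (a - δ) a, Γ t = pev γ' a + (t - a) • u := by
    intro t ht
    simp only [Γ]
    rw [hcongr ht.1 fun r hr => hG1 r ⟨hr.1, hr.2.trans ht.2⟩, intervalIntegral.integral_const]
    have : t - (a - δ) = (t - a) + δ := by ring
    rw [this, add_smul, hu']
    abel
  have hΓa : Γ a = pev γ' a := by simpa using hΓ1 a ⟨haδ, le_rfl⟩
  have hΓ2 : ∀ t ∈ Set.Icc a b, Γ t = pev γ' t := by
    intro t ht
    rw [hΓadd a t, hΓa, hcongr ht.1 fun r hr => hG2 r ⟨hr.1, hr.2.trans ht.2⟩]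
    exact (hg.pev_eq (Set.left_mem_Icc.2 hab.le) ht).symm
  have hΓb : Γ b = pev γ' b := hΓ2 b ⟨hab.le, le_rfl⟩
  have hΓ3 : ∀ t ∈ Set.Icc b (b + δ), Γ t = pev γ' b + (t - b) • w := by
    intro t ht
    rw [hΓadd b t, hΓb, hcongr ht.1 fun r hr => hG3 r ⟨hr.1, hr.2.trans ht.2⟩,
      intervalIntegral.integral_const]
  have hΓend : Γ (b + δ) = y := by
    rw [hΓ3 _ ⟨hbδ, le_rfl⟩, add_sub_cancel_left, hw']
    abel
  classical
  let κ : ℝ≥0 := ⟨1 - θ, by linarith⟩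
  let ρ : ℝ → ℝ≥0 := fun t => if t ∈ E then κ else 1
  have hρ : Measurable ρ := Measurable.ite hE measurable_const measurable_const
  have hρE {t : ℝ} (ht : t ∈ E) : ρ t = κ := if_pos ht
  have hρE' {t : ℝ} (ht : t ∉ E) : ρ t = 1 := if_neg ht
  have hκ : (κ : ℝ) = 1 - θ := rfl
  have hρ1 (t : ℝ) : 1 / 2 ≤ ρ t := by
    by_cases ht : t ∈ E
    · rw [hρE ht, ← NNReal.coe_le_coe, hκ]
      push_cast
      linarith
    · rw [hρE' ht, ← NNReal.coe_le_coe]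
      norm_num
  have hρ2 (t : ℝ) : ρ t ≤ 1 := by
    by_cases ht : t ∈ E
    · rw [hρE ht, ← NNReal.coe_le_coe, hκ]
      push_cast
      linarith
    · rw [hρE' ht]
  have hlen : ∫ t in (a - δ)..(b + δ), (ρ t : ℝ) = b - a := by
    have hρeq : (fun t => (ρ t : ℝ)) = fun t => 1 - E.indicator (fun _ => θ) t := by
      ext t
      by_cases ht : t ∈ E
      · simp [hρE ht, ht, hκ]
      · simp [hρE' ht, ht]
    have hint : IntegrableOn (E.indicator fun _ => θ) (Set.Ioc (a - δ) (b + δ)) :=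
      ((integrable_indicator_iff hE).2 (integrableOn_const hEfin)).integrableOn
    have hone : IntegrableOn (fun _ : ℝ => (1 : ℝ)) (Set.Ioc (a - δ) (b + δ)) :=
      integrableOn_const (by simp)
    rw [hρeq, intervalIntegral.integral_of_le (by linarith), integral_sub hone hint, setIntegral_indicator hE,
      Set.inter_eq_right.2 (hEab.trans (Set.Ioc_subset_Ioc haδ hbδ))]
    simp only [setIntegral_const, Real.volume_real_Ioc, smul_eq_mul, mul_one]
    rw [max_eq_left (by linarith), ← hm]
    simp only [hδ]
    ring
  obtain ⟨γ, h, hγ, hγa, hγb, hγF⟩ :=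
    exists_isVelocity_timeChange hab.le hG hρ hρ1 hρ2 hlen x
  refine ⟨γ, hγ.isACC, hγa, hγb.trans hΓend, (hγ.action_le_coe_iff L _).2 ?_⟩
  let Φ : ℝ → ℝ := fun t => (ρ t : ℝ) * L (Γ t) ((ρ t)⁻¹ • G t)
  have hΦ1 : IntegrableOn Φ (Set.Ioc (a - δ) a) ∧
      ∫ t in Set.Ioc (a - δ) a, Φ t ≤ (a - (a - δ)) * B := by
    refine integrableOn_Ioc_and_setIntegral_le (h := fun t => L (pev γ' a + (t - a) • u) u) haδ
      ?_ ?_ ?_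
    · exact hL.comp (by fun_prop : Continuous fun t : ℝ => (pev γ' a + (t - a) • u, u))
    · intro t ht
      have htE : t ∉ E := fun h => absurd (hEab h).1 (not_lt.2 ht.2)
      simp only [Φ, hρE' htE, hG1 t ht, hΓ1 t ⟨ht.1.le, ht.2⟩]
      simp
    · intro t ht
      refine (le_abs_self _).trans (hB _ (Or.inl ?_) _ (mem_closedBall_zero_iff.2 hu1))
      rw [mem_closedBall_iff_norm, add_sub_cancel_left, norm_smul, Real.norm_eq_abs]
      have : |t - a| ≤ 1 := by
        rw [abs_le]; constructor <;> linarith [ht.1, ht.2]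
      exact mul_le_one₀ this (norm_nonneg _) hu1
  have hΦ3 : IntegrableOn Φ (Set.Ioc b (b + δ)) ∧
      ∫ t in Set.Ioc b (b + δ), Φ t ≤ (b + δ - b) * B := by
    refine integrableOn_Ioc_and_setIntegral_le (h := fun t => L (pev γ' b + (t - b) • w) w) hbδ
      ?_ ?_ ?_
    · exact hL.comp (by fun_prop : Continuous fun t : ℝ => (pev γ' b + (t - b) • w, w))
    · intro t ht
      have htE : t ∉ E := fun h => absurd (hEab h).2 (not_le.2 ht.1)
      simp only [Φ, hρE' htE, hG3 t ht, hΓ3 t ⟨ht.1.le, ht.2⟩]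
      simp
    · intro t ht
      refine (le_abs_self _).trans (hB _ (Or.inr ?_) _ (mem_closedBall_zero_iff.2 hw1))
      rw [mem_closedBall_iff_norm, add_sub_cancel_left, norm_smul, Real.norm_eq_abs]
      have : |t - b| ≤ 1 := by
        rw [abs_le]; constructor <;> linarith [ht.1, ht.2]
      exact mul_le_one₀ this (norm_nonneg _) hw1
  have hAE : IntegrableOn (fun t => L (pev γ' t) (g t)) (Set.Ioc a b) :=
    hA.1.mono_set Set.Ioc_subset_Icc_self
  have hΦE : ∀ t ∈ E, (1 - θ) * L (pev γ' t) ((1 - θ)⁻¹ • g t) = Φ t := by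
    intro t ht
    simp only [Φ, hρE ht, hG2 t (hEab ht), hΓ2 t (Set.Ioc_subset_Icc_self (hEab ht))]
    rfl
  have hΦE' : ∀ t ∈ Set.Ioc a b \ E, L (pev γ' t) (g t) = Φ t := by
    intro t ht
    simp only [Φ, hρE' ht.2, hG2 t ht.1, hΓ2 t (Set.Ioc_subset_Icc_self ht.1)]
    simp
  have hdm : MeasurableSet (Set.Ioc a b \ E) := measurableSet_Ioc.diff hE
  have hΦEi : IntegrableOn Φ E := (hsi θ ⟨hθ0.le, hθ2.le⟩).congr_fun hΦE hE
  have hΦE'i : IntegrableOn Φ (Set.Ioc a b \ E) :=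
    (hAE.mono_set Set.sdiff_subset).congr_fun hΦE' hdm
  have hΦ2 : IntegrableOn Φ (Set.Ioc a b) := by
    rw [← Set.union_sdiff_cancel hEab]
    exact hΦEi.union hΦE'i
  have hΦ2le : ∫ t in Set.Ioc a b, Φ t ≤ A + ε / 2 := by
    have e1 : ∫ t in Set.Ioc a b, Φ t = (∫ t in E, Φ t) + ∫ t in Set.Ioc a b \ E, Φ t := by
      rw [← setIntegral_union disjoint_sdiff_self_right hdm hΦEi hΦE'i,
        Set.union_sdiff_cancel hEab]
    have e2 : ∫ t in Set.Ioc a b, L (pev γ' t) (g t) =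
        (∫ t in E, L (pev γ' t) (g t)) + ∫ t in Set.Ioc a b \ E, L (pev γ' t) (g t) := by
      rw [← setIntegral_union disjoint_sdiff_self_right hdm (hAE.mono_set hEab)
        (hAE.mono_set Set.sdiff_subset), Set.union_sdiff_cancel hEab]
    have hA2 := hA.2
    rw [integral_Icc_eq_integral_Ioc, e2] at hA2
    rw [e1, ← setIntegral_congr_fun hE hΦE, ← setIntegral_congr_fun hdm hΦE']
    linarith
  have hΦ12 : IntegrableOn Φ (Set.Ioc (a - δ) b) := by
    rw [← Set.Ioc_union_Ioc_eq_Ioc haδ hab.le]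
    exact hΦ1.1.union hΦ2
  have hΦ : IntegrableOn Φ (Set.Ioc (a - δ) (b + δ)) := by
    rw [← Set.Ioc_union_Ioc_eq_Ioc (haδ.trans hab.le) hbδ]
    exact hΦ12.union hΦ3.1
  obtain ⟨hi, he⟩ := hγF L ((integrableOn_Icc_iff_integrableOn_Ioc (by finiteness)).2 hΦ)
  refine ⟨hi, ?_⟩
  rw [he, integral_Icc_eq_integral_Ioc]
  change ∫ t in Set.Ioc (a - δ) (b + δ), Φ t ≤ _
  rw [← Set.Ioc_union_Ioc_eq_Ioc (haδ.trans hab.le) hbδ,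
    setIntegral_union (Set.Ioc_disjoint_Ioc_of_le le_rfl) measurableSet_Ioc hΦ12 hΦ3.1,
    ← Set.Ioc_union_Ioc_eq_Ioc haδ hab.le,
    setIntegral_union (Set.Ioc_disjoint_Ioc_of_le le_rfl) measurableSet_Ioc hΦ1.1 hΦ2]
  have h2 : 2 * (δ * B) < ε / 2 := by
    simp only [hδ]
    linarith
  linarith [hΦ1.2, hΦ3.2]

/-- Bounded sequences in a Hilbert space converge weakly along every ultrafilter. -/
lemma exists_tendsto_inner_of_norm_le {ι H : Type*} [NormedAddCommGroup H] [InnerProductSpace ℝ H]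
    [CompleteSpace H] (U : Ultrafilter ι) {f : ι → H} {C : ℝ} (hf : ∀ j, ‖f j‖ ≤ C) :
    ∃ g : H, ∀ p : H, Tendsto (fun j => inner ℝ p (f j)) U (𝓝 (inner ℝ p g)) := by
  have hK := WeakDual.isCompact_closedBall (𝕜 := ℝ) (E := H) 0 C
  let F : ι → WeakDual ℝ H := fun j => StrongDual.toWeakDual (InnerProductSpace.toDual ℝ H (f j))
  have hF : (U.map F : Filter (WeakDual ℝ H)) ≤
      𝓟 (WeakDual.toStrongDual ⁻¹' Metric.closedBall 0 C) := by
    rw [le_principal_iff]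
    change ∀ᶠ j in (U : Filter ι), F j ∈ _
    refine Eventually.of_forall fun j => ?_
    simpa [F] using hf j
  obtain ⟨G, -, hG⟩ := hK.ultrafilter_le_nhds (U.map F) hF
  refine ⟨(InnerProductSpace.toDual ℝ H).symm (WeakDual.toStrongDual G), fun p => ?_⟩
  have h := ((WeakDual.eval_continuous p).tendsto G).comp hG
  rw [real_inner_comm, InnerProductSpace.toDual_symm_apply]
  refine Tendsto.congr (fun j => ?_) (h : Tendsto (fun j => F j p) U _)
  rw [real_inner_comm]
  rfl

/-- Bounded sequences in `L²` converge weakly along every ultrafilter. -/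
lemma exists_tendsto_integral_inner {ι α E : Type*} [MeasurableSpace α] {μ : Measure α}
    [NormedAddCommGroup E] [InnerProductSpace ℝ E] [CompleteSpace E] (U : Ultrafilter ι)
    {f : ι → α → E} {C : ℝ} (hf : ∀ j, MemLp (f j) 2 μ) (hC : ∀ j, ∫ t, ‖f j t‖ ^ 2 ∂μ ≤ C) :
    ∃ g : α → E, StronglyMeasurable g ∧ MemLp g 2 μ ∧ ∀ p : α → E, MemLp p 2 μ →
      Tendsto (fun j => ∫ t, inner ℝ (p t) (f j t) ∂μ) U (𝓝 (∫ t, inner ℝ (p t) (g t) ∂μ)) := by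
  have hb (j : ι) : ‖(hf j).toLp‖ ≤ √C := by
    refine Real.le_sqrt_of_sq_le ?_
    rw [← real_inner_self_eq_norm_sq, L2.inner_def]
    refine le_of_eq_of_le (integral_congr_ae ?_) (hC j)
    filter_upwards [(hf j).coeFn_toLp] with t ht
    rw [ht, real_inner_self_eq_norm_sq]
  obtain ⟨g, hg⟩ := exists_tendsto_inner_of_norm_le (H := Lp E 2 μ) U hb
  refine ⟨g, Lp.stronglyMeasurable g, Lp.memLp g, fun p hp => ?_⟩
  have h := hg hp.toLp
  simp only [L2.inner_def] at h
  have e (j : ι) : ∫ t, inner ℝ (hp.toLp p t) ((hf j).toLp (f j) t) ∂μ =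
      ∫ t, inner ℝ (p t) (f j t) ∂μ := by
    refine integral_congr_ae ?_
    filter_upwards [hp.coeFn_toLp, (hf j).coeFn_toLp] with t h1 h2
    rw [h1, h2]
  have e' : ∫ t, inner ℝ (hp.toLp p t) (g t) ∂μ = ∫ t, inner ℝ (p t) (g t) ∂μ := by
    refine integral_congr_ae ?_
    filter_upwards [hp.coeFn_toLp] with t h1
    rw [h1]
  simpa only [e, e'] using h

/-- Weak lower semicontinuity of a nonnegative integral functional that is convex in the
velocity. -/
lemma integrable_and_integral_le_of_tendsto_integral_inner {ι α E : Type*} [MeasurableSpace α]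
    {μ : Measure α} [IsFiniteMeasure μ] [NormedAddCommGroup E] [InnerProductSpace ℝ E]
    [FiniteDimensional ℝ E] {l : Filter ι} [l.NeBot] {P : E → E → ℝ} {D : E → E → E}
    (hP : Continuous (Function.uncurry P)) (hD : Continuous (Function.uncurry D))
    (hP0 : ∀ x v, 0 ≤ P x v) (hPD : ∀ x v u, P x v + inner ℝ (D x v) (u - v) ≤ P x u)
    {x : α → E} (hx : AEStronglyMeasurable x μ) {C : ℝ} (hxC : ∀ t, ‖x t‖ ≤ C)
    {y : ι → α → E} (hy : TendstoUniformly y x l) {f : ι → α → E} (hf : ∀ j, Integrable (f j) μ)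
    {M : ℝ} (hfM : ∀ j, ∫ t, ‖f j t‖ ∂μ ≤ M) {g : α → E} (hg : StronglyMeasurable g)
    (hgi : Integrable g μ)
    (hfg : ∀ p : α → E, AEStronglyMeasurable p μ → (∃ B, ∀ t, ‖p t‖ ≤ B) →
      Tendsto (fun j => ∫ t, inner ℝ (p t) (f j t) ∂μ) l (𝓝 (∫ t, inner ℝ (p t) (g t) ∂μ)))
    {A : ℝ} (hi : ∀ j, Integrable (fun t => P (y j t) (f j t)) μ)
    (hA : ∀ j, ∫ t, P (y j t) (f j t) ∂μ ≤ A) :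
    Integrable (fun t => P (x t) (g t)) μ ∧ ∫ t, P (x t) (g t) ∂μ ≤ A := by
  have hPm : AEStronglyMeasurable (fun t => P (x t) (g t)) μ :=
    hP.comp_aestronglyMeasurable (hx.prodMk hg.aestronglyMeasurable)
  have hDm : AEStronglyMeasurable (fun t => D (x t) (g t)) μ :=
    hD.comp_aestronglyMeasurable (hx.prodMk hg.aestronglyMeasurable)
  let S : ℕ → Set α := fun k => {t | ‖g t‖ ≤ k}
  have hS (k : ℕ) : MeasurableSet (S k) :=
    measurableSet_le hg.norm.measurable measurable_const
  have hK (k : ℕ) : IsCompact (Metric.closedBall (0 : E) C ×ˢ Metric.closedBall (0 : E) k) :=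
    (isCompact_closedBall _ _).prod (isCompact_closedBall _ _)
  have hmem (k : ℕ) {t : α} (ht : t ∈ S k) :
      (x t, g t) ∈ Metric.closedBall (0 : E) C ×ˢ Metric.closedBall (0 : E) k :=
    ⟨mem_closedBall_zero_iff.2 (hxC t), mem_closedBall_zero_iff.2 ht⟩
  have hPS (k : ℕ) : IntegrableOn (fun t => P (x t) (g t)) (S k) μ := by
    obtain ⟨B, hB⟩ := (hK k).exists_bound_of_continuousOn hP.continuousOn
    exact IntegrableOn.of_bound (measure_lt_top _ _) hPm.restrict B
      ((ae_restrict_iff' (hS k)).2 (ae_of_all _ fun t ht => hB _ (hmem k ht)))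
  have hle (k : ℕ) : ∫ t in S k, P (x t) (g t) ∂μ ≤ A := by
    obtain ⟨B, hB⟩ := (hK k).exists_bound_of_continuousOn hD.continuousOn
    let p : α → E := (S k).indicator fun t => D (x t) (g t)
    have hpm : AEStronglyMeasurable p μ := hDm.indicator (hS k)
    have hpB (t : α) : ‖p t‖ ≤ max B 0 := by
      by_cases ht : t ∈ S k
      · simp only [p, Set.indicator_of_mem ht]
        exact (hB _ (hmem k ht)).trans (le_max_left _ _)
      · simp [p, Set.indicator_of_notMem ht]
    have hpi {h : α → E} (hh : Integrable h μ) : Integrable (fun t => inner ℝ (p t) (h t)) μ := by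
      refine (hh.norm.const_mul (max B 0)).mono' (hpm.inner hh.aestronglyMeasurable)
        (ae_of_all _ fun t => ?_)
      exact (norm_inner_le_norm _ _).trans (mul_le_mul_of_nonneg_right (hpB t) (norm_nonneg _))
    have hlim := hfg p hpm ⟨_, hpB⟩
    set N : ℝ := μ.real Set.univ + M + ∫ t, ‖g t‖ ∂μ with hN
    have key (ε : ℝ) (hε : 0 < ε) : (∫ t in S k, P (x t) (g t) ∂μ) - ε * N ≤ A := by
      have hev : ∀ᶠ j in l, (∫ t in S k, P (x t) (g t) ∂μ) - ε * N +
          ((∫ t, inner ℝ (p t) (f j t) ∂μ) - ∫ t, inner ℝ (p t) (g t) ∂μ) ≤ A := by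
        have u1 := (hK k).uniformContinuousAt_of_continuousAt (Function.uncurry P)
          (fun z _ => hP.continuousAt) (Metric.dist_mem_uniformity hε)
        have u2 := (hK k).uniformContinuousAt_of_continuousAt (Function.uncurry D)
          (fun z _ => hD.continuousAt) (Metric.dist_mem_uniformity hε)
        obtain ⟨δ, hδ, hu⟩ := Metric.mem_uniformity_dist.1 (inter_mem u1 u2)
        filter_upwards [Metric.tendstoUniformly_iff.1 hy δ hδ] with j hj
        have hpt (t : α) : (S k).indicator (fun t => P (x t) (g t)) t +
            (inner ℝ (p t) (f j t) - inner ℝ (p t) (g t)) - ε * (1 + ‖f j t‖ + ‖g t‖) ≤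
            P (y j t) (f j t) := by
          have hpos : 0 ≤ ε * (1 + ‖f j t‖ + ‖g t‖) := by positivity
          by_cases ht : t ∈ S k
          · have hd : dist (x t, g t) (y j t, g t) < δ := by
              rw [Prod.dist_eq, dist_self, max_eq_left dist_nonneg]
              exact hj t
            obtain ⟨h1, h2⟩ := hu hd
            have h1 : dist (P (x t) (g t)) (P (y j t) (g t)) < ε := h1 (hmem k ht)
            have h2 : dist (D (x t) (g t)) (D (y j t) (g t)) < ε := h2 (hmem k ht)
            have h3 := hPD (y j t) (g t) (f j t)
            have h4 : inner ℝ (D (x t) (g t) - D (y j t) (g t)) (f j t - g t) ≤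
                ε * (‖f j t‖ + ‖g t‖) :=
              (real_inner_le_norm _ _).trans (mul_le_mul (by rw [← dist_eq_norm]; exact h2.le)
                (norm_sub_le _ _) (norm_nonneg _) hε.le)
            rw [Real.dist_eq] at h1
            have h5 := (abs_lt.1 h1).2
            rw [inner_sub_left] at h4
            simp only [p, Set.indicator_of_mem ht, ← inner_sub_right]
            linarith
          · simp only [p, Set.indicator_of_notMem ht, inner_zero_left]
            linarith [hP0 (y j t) (f j t)]
        have i1 : Integrable ((S k).indicator fun t => P (x t) (g t)) μ :=
          (integrable_indicator_iff (hS k)).2 (hPS k)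
        have i2 : Integrable (fun t => inner ℝ (p t) (f j t) - inner ℝ (p t) (g t)) μ :=
          (hpi (hf j)).sub (hpi hgi)
        have i12 : Integrable (fun t => (S k).indicator (fun t => P (x t) (g t)) t +
          (inner ℝ (p t) (f j t) - inner ℝ (p t) (g t))) μ := i1.add i2
        have i4 : Integrable (fun t => 1 + ‖f j t‖) μ := (integrable_const 1).add (hf j).norm
        have i3 : Integrable (fun t => 1 + ‖f j t‖ + ‖g t‖) μ :=
          i4.add hgi.norm
        have hint := integral_mono (i12.sub (i3.const_mul ε)) (hi j) hpt
        simp only [Pi.sub_apply] at hint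
        rw [integral_sub i12 (i3.const_mul ε), integral_add i1 i2,
          integral_indicator (hS k), integral_sub (hpi (hf j)) (hpi hgi), integral_const_mul,
          integral_add i4 hgi.norm,
          integral_add (integrable_const 1) (hf j).norm] at hint
        simp only [integral_const, smul_eq_mul, mul_one] at hint
        have := mul_le_mul_of_nonneg_left (hfM j) hε.le
        have := hA j
        rw [hN]
        linarith
      have hl := (hlim.sub_const (∫ t, inner ℝ (p t) (g t) ∂μ)).const_add
        ((∫ t in S k, P (x t) (g t) ∂μ) - ε * N)
      rw [sub_self, add_zero] at hl
      exact le_of_tendsto hl hev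
    have hl : Tendsto (fun ε : ℝ => (∫ t in S k, P (x t) (g t) ∂μ) - ε * N) (𝓝[>] 0)
        (𝓝 (∫ t in S k, P (x t) (g t) ∂μ)) := by
      have hc : Continuous fun ε : ℝ => (∫ t in S k, P (x t) (g t) ∂μ) - ε * N := by fun_prop
      exact tendsto_nhdsWithin_of_tendsto_nhds (by simpa using hc.tendsto 0)
    exact le_of_tendsto hl (eventually_mem_nhdsWithin.mono key)
  have hcover : AECover μ atTop S :=
    ⟨ae_of_all _ fun t => by
      filter_upwards [eventually_ge_atTop ⌈‖g t‖⌉₊] with k hk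
      exact (Nat.le_ceil _).trans (Nat.cast_le.2 hk), hS⟩
  have hint : Integrable (fun t => P (x t) (g t)) μ :=
    hcover.integrable_of_integral_bounded_of_nonneg_ae A hPS
      (ae_of_all _ fun t => hP0 _ _) (Eventually.of_forall hle)
  exact ⟨hint, le_of_tendsto' (hcover.integral_tendsto_of_countably_generated hint) hle⟩

lemma norm_pev_le {a b : ℝ} {n : ℕ} (γ : CPath a b n) (t : ℝ) : ‖pev γ t‖ ≤ ‖γ‖ := by
  by_cases ht : t ∈ Set.Icc a b
  · rw [pev_of_mem γ ht]
    exact γ.norm_coe_le_norm _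
  · simp [pev, ht]

lemma dist_pev_le {a b : ℝ} {n : ℕ} (γ γ' : CPath a b n) (t : ℝ) :
    dist (pev γ t) (pev γ' t) ≤ dist γ γ' := by
  by_cases ht : t ∈ Set.Icc a b
  · rw [pev_of_mem γ ht, pev_of_mem γ' ht]
    exact ContinuousMap.dist_apply_le_dist _
  · simp [pev, ht]

lemma continuous_pev {a b : ℝ} {n : ℕ} (t : ℝ) : Continuous fun γ : CPath a b n => pev γ t :=
  (LipschitzWith.of_dist_le_mul (K := 1) fun γ γ' => by
    simpa using dist_pev_le γ γ' t).continuous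

lemma setIntegral_inner_indicator {E : Type*} [NormedAddCommGroup E] [InnerProductSpace ℝ E]
    [CompleteSpace E] {a b : ℝ} {h : ℝ → E} (hh : IntegrableOn h (Set.Icc a b)) {s t : ℝ}
    (hs : s ∈ Set.Icc a b) (ht : t ∈ Set.Icc a b) (hst : s ≤ t) (e : E) :
    ∫ u in Set.Icc a b, inner ℝ ((Set.Ioc s t).indicator (fun _ => e) u) (h u) =
      inner ℝ e (∫ u in s..t, h u) := by
  have hsub : Set.Ioc s t ⊆ Set.Icc a b := fun u hu => ⟨hs.1.trans hu.1.le, hu.2.trans ht.2⟩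
  have heq : (fun u => inner ℝ ((Set.Ioc s t).indicator (fun _ => e) u) (h u)) =
      (Set.Ioc s t).indicator fun u => inner ℝ e (h u) := by
    ext u
    by_cases hu : u ∈ Set.Ioc s t <;> simp [hu]
  rw [heq, setIntegral_indicator measurableSet_Ioc, Set.inter_eq_right.2 hsub,
    intervalIntegral.integral_of_le hst, integral_inner (hh.mono_set hsub)]

/-- A uniform limit of curves with weakly convergent velocities has the weak limit as velocity. -/
lemma isVelocity_of_tendsto {ι : Type*} {l : Filter ι} [l.NeBot] {a b : ℝ} {n : ℕ}
    {γs : ι → CPath a b n} {γ : CPath a b n} (hγ : Tendsto γs l (𝓝 γ)) {gs : ι → ℝ → Eu n}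
    (hv : ∀ j, IsVelocity (γs j) (gs j)) {g : ℝ → Eu n} (hg : IntegrableOn g (Set.Icc a b))
    (hlim : ∀ p : ℝ → Eu n, AEStronglyMeasurable p (volume.restrict (Set.Icc a b)) →
      (∃ B, ∀ t, ‖p t‖ ≤ B) → Tendsto (fun j => ∫ t in Set.Icc a b, inner ℝ (p t) (gs j t)) l
        (𝓝 (∫ t in Set.Icc a b, inner ℝ (p t) (g t)))) :
    IsVelocity γ g := by
  have key (s t : Set.Icc a b) (hst : s ≤ t) : γ t = γ s + ∫ u in (s : ℝ)..t, g u := by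
    rw [← sub_eq_iff_eq_add']
    refine ext_inner_left ℝ fun e => ?_
    have h1 : Tendsto (fun j => inner ℝ e (γs j t - γs j s)) l (𝓝 (inner ℝ e (γ t - γ s))) :=
      tendsto_const_nhds.inner ((((continuous_eval_const t).tendsto γ).comp hγ).sub
        (((continuous_eval_const s).tendsto γ).comp hγ))
    have h2 := hlim ((Set.Ioc (s : ℝ) t).indicator fun _ => e)
      (aestronglyMeasurable_const.indicator measurableSet_Ioc)
      ⟨‖e‖, fun u => norm_indicator_le_norm_self _ _⟩
    rw [setIntegral_inner_indicator hg s.2 t.2 hst] at h2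
    refine tendsto_nhds_unique h1 (h2.congr fun j => ?_)
    rw [setIntegral_inner_indicator (hv j).1 s.2 t.2 hst, (hv j).2 s t, add_sub_cancel_left]
  refine ⟨hg, fun s t => ?_⟩
  rcases le_total s t with hst | hst
  · exact key s t hst
  · rw [key t s hst, intervalIntegral.integral_symm (t : ℝ) s, add_neg_cancel_right]

/-- Lower semicontinuity of the action along curves of bounded kinetic energy. -/
lemma isACC_and_action_le_of_tendsto {ι : Type*} {l : Filter ι} [l.NeBot] {a b : ℝ} {n : ℕ}
    {L : Eu n → Eu n → ℝ} (hL : Continuous (Function.uncurry L))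
    (hdL : Continuous (Function.uncurry fun x v => fderiv ℝ (L x) v))
    (hconv : ∀ x v u, L x v + fderiv ℝ (L x) v (u - v) ≤ L x u) {c : ℝ} (hc : ∀ x v, -c ≤ L x v)
    {γs : ι → CPath a b n} {γ : CPath a b n} (hγ : Tendsto γs l (𝓝 γ)) {gs : ι → ℝ → Eu n}
    (hv : ∀ j, IsVelocity (γs j) (gs j))
    (hgs : ∀ j, MemLp (gs j) 2 (volume.restrict (Set.Icc a b))) {M : ℝ}
    (hM : ∀ j, ∫ t in Set.Icc a b, ‖gs j t‖ ^ 2 ≤ M) {A : ℝ}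
    (hA : ∀ j, action L a b (γs j) ≤ A) : IsACC γ ∧ action L a b γ ≤ A := by
  obtain ⟨g, hgm, hg2, hlim⟩ := exists_tendsto_integral_inner (Ultrafilter.of l) hgs hM
  have hgi : IntegrableOn g (Set.Icc a b) := hg2.integrable (by norm_num)
  have hlim' (p : ℝ → Eu n) (hp : AEStronglyMeasurable p (volume.restrict (Set.Icc a b)))
      (hB : ∃ B, ∀ t, ‖p t‖ ≤ B) : Tendsto (fun j => ∫ t in Set.Icc a b, inner ℝ (p t) (gs j t))
        (Ultrafilter.of l) (𝓝 (∫ t in Set.Icc a b, inner ℝ (p t) (g t))) :=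
    hlim p (MemLp.of_bound hp hB.choose (ae_of_all _ hB.choose_spec))
  have hγU : Tendsto γs (Ultrafilter.of l) (𝓝 γ) := hγ.mono_left (Ultrafilter.of_le l)
  have hvel : IsVelocity γ g := isVelocity_of_tendsto hγU hv hgi hlim'
  have hact (j : ι) := ((hv j).action_le_coe_iff L A).1 (hA j)
  have hcI : Integrable (fun _ : ℝ => c) (volume.restrict (Set.Icc a b)) := integrable_const c
  have h1M (j : ι) : ∫ t in Set.Icc a b, ‖gs j t‖ ≤ (∫ t in Set.Icc a b, (1 : ℝ)) + M := by
    have hi := (hgs j).integrable_norm_pow (by norm_num : (2 : ℕ) ≠ 0)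
    refine le_trans ?_ (add_le_add_right (hM j) _)
    rw [← integral_add (integrable_const 1) hi]
    refine integral_mono (hv j).1.norm ((integrable_const 1).add hi) fun t => ?_
    change ‖gs j t‖ ≤ 1 + ‖gs j t‖ ^ 2
    nlinarith [sq_nonneg (‖gs j t‖ - 1), norm_nonneg (gs j t)]
  have hy : TendstoUniformly (fun j => pev (γs j)) (pev γ) (Ultrafilter.of l) := by
    rw [Metric.tendstoUniformly_iff]
    intro ε hε
    filter_upwards [Metric.tendsto_nhds.1 hγU ε hε] with j hj t
    rw [dist_comm]
    exact (dist_pev_le _ _ t).trans_lt hj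
  obtain ⟨hi, hle⟩ := integrable_and_integral_le_of_tendsto_integral_inner
    (P := fun x v => L x v + c)
    (D := fun x v => (InnerProductSpace.toDual ℝ (Eu n)).symm (fderiv ℝ (L x) v))
    (A := A + ∫ t in Set.Icc a b, c)
    (show Continuous (fun z : Eu n × Eu n => Function.uncurry L z + c) from
      hL.add continuous_const)
    ((InnerProductSpace.toDual ℝ (Eu n)).symm.continuous.comp hdL)
    (fun x v => by linarith [hc x v])
    (fun x v u => by
      rw [InnerProductSpace.toDual_symm_apply]
      linarith [hconv x v u])
    ((continuousOn_pev γ).aestronglyMeasurable measurableSet_Icc) (norm_pev_le γ) hy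
    (fun j => (hv j).1) h1M hgm hgi hlim' (fun j => (hact j).1.add hcI)
    (fun j => by
      rw [integral_add (hact j).1 hcI]
      linarith [(hact j).2])
  have hi' : IntegrableOn (fun t => L (pev γ t) (g t)) (Set.Icc a b) := by
    exact (hi.sub hcI).congr (ae_of_all _ fun t => add_sub_cancel_right _ _)
  refine ⟨hvel.isACC, (hvel.action_le_coe_iff L A).2 ⟨hi', ?_⟩⟩
  rw [integral_add hi' hcI] at hle
  linarith

/-- A function that is locally uniformly convex in the velocity grows quadratically, locally
uniformly in the position. -/
lemma exists_mul_sq_sub_le {n : ℕ} {L : Eu n → Eu n → ℝ} (hL : Continuous (Function.uncurry L))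
    (hdL : Continuous (Function.uncurry fun x v => fderiv ℝ (L x) v))
    {K : Set (Eu n)} (hK : IsCompact K) {c : ℝ} (hc : 0 < c)
    (hconv : ∀ x ∈ K, ∀ v u, L x v + fderiv ℝ (L x) v (u - v) + c / 2 * ‖u - v‖ ^ 2 ≤ L x u) :
    ∃ C, ∀ x ∈ K, ∀ v, c / 4 * ‖v‖ ^ 2 - C ≤ L x v := by
  have hz : Continuous fun x : Eu n => (x, (0 : Eu n)) := by fun_prop
  obtain ⟨B, hB⟩ := hK.exists_bound_of_continuousOn (hL.comp hz).continuousOn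
  obtain ⟨B', hB'⟩ := hK.exists_bound_of_continuousOn (hdL.comp hz).continuousOn
  refine ⟨B + B' ^ 2 / c, fun x hx v => ?_⟩
  have h1 := hconv x hx 0 v
  have h2 : |L x 0| ≤ B := hB x hx
  have h3 : ‖fderiv ℝ (L x) 0‖ ≤ B' := hB' x hx
  have h4 : |fderiv ℝ (L x) 0 v| ≤ B' * ‖v‖ := ContinuousLinearMap.le_of_opNorm_le _ h3 v
  rw [sub_zero] at h1
  have h5 : B' * ‖v‖ ≤ c / 4 * ‖v‖ ^ 2 + B' ^ 2 / c := by
    have : c / 4 * ‖v‖ ^ 2 + B' ^ 2 / c - B' * ‖v‖ = (c / 2 * ‖v‖ - B') ^ 2 / c := by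
      field_simp
      ring
    have : 0 ≤ (c / 2 * ‖v‖ - B') ^ 2 / c := by positivity
    linarith
  linarith [neg_abs_le (L x 0), neg_abs_le (fderiv ℝ (L x) 0 v)]

/-- Under linear growth in the velocity, curves of bounded action issued from a bounded set
stay in a bounded set. -/
lemma IsVelocity.norm_pev_le_of_action_le {a b : ℝ} {n : ℕ} {L : Eu n → Eu n → ℝ} {c₁ c₂ : ℝ}
    (hc₁ : 0 < c₁) (hL : ∀ x v, c₁ * ‖v‖ - c₂ ≤ L x v) {γ : CPath a b n} {g : ℝ → Eu n}
    (hv : IsVelocity γ g) {A : ℝ} (hA : action L a b γ ≤ A) {t : ℝ} (ht : t ∈ Set.Icc a b) :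
    ‖pev γ t‖ ≤ ‖pev γ a‖ + (A + ∫ _ in Set.Icc a b, c₂) / c₁ := by
  obtain ⟨hi, hle⟩ := (hv.action_le_coe_iff L A).1 hA
  have hcI : Integrable (fun _ : ℝ => c₂) (volume.restrict (Set.Icc a b)) := integrable_const c₂
  have ha : a ∈ Set.Icc a b := Set.left_mem_Icc.2 (ht.1.trans ht.2)
  have h1 : c₁ * ∫ t in Set.Icc a b, ‖g t‖ ≤ A + ∫ _ in Set.Icc a b, c₂ := by
    refine le_trans ?_ (add_le_add_left hle _)
    rw [← integral_const_mul, ← integral_add hi hcI]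
    refine integral_mono (hv.1.norm.const_mul c₁) (hi.add hcI) fun t => ?_
    change c₁ * ‖g t‖ ≤ L (pev γ t) (g t) + c₂
    linarith [hL (pev γ t) (g t)]
  rw [hv.pev_eq ha ht]
  refine (norm_add_le _ _).trans (add_le_add_right ?_ _)
  rw [le_div_iff₀' hc₁]
  refine le_trans (mul_le_mul_of_nonneg_left ?_ hc₁.le) h1
  refine intervalIntegral.norm_integral_le_integral_norm_uIoc.trans ?_
  refine setIntegral_mono_set hv.1.norm (ae_of_all _ fun _ => norm_nonneg _)
    (LE.le.eventuallyLE ?_)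
  exact Set.uIoc_subset_uIcc.trans (Set.uIcc_subset_Icc ha ht)

/-- Quadratic growth bounds the kinetic energy in terms of the action. -/
lemma IsVelocity.memLp_two_of_action_le {a b : ℝ} {n : ℕ} {L : Eu n → Eu n → ℝ} {c C : ℝ}
    (hc : 0 < c) {K : Set (Eu n)} (hL : ∀ x ∈ K, ∀ v, c * ‖v‖ ^ 2 - C ≤ L x v) {γ : CPath a b n}
    {g : ℝ → Eu n} (hv : IsVelocity γ g) (hK : ∀ t ∈ Set.Icc a b, pev γ t ∈ K) {A : ℝ}
    (hA : action L a b γ ≤ A) :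
    MemLp g 2 (volume.restrict (Set.Icc a b)) ∧
      ∫ t in Set.Icc a b, ‖g t‖ ^ 2 ≤ (A + ∫ _ in Set.Icc a b, C) / c := by
  obtain ⟨hi, hle⟩ := (hv.action_le_coe_iff L A).1 hA
  have hcI : Integrable (fun _ : ℝ => C) (volume.restrict (Set.Icc a b)) := integrable_const C
  have hpt : ∀ᵐ t ∂(volume.restrict (Set.Icc a b)),
      ‖g t‖ ^ 2 ≤ c⁻¹ * (L (pev γ t) (g t) + C) := by
    refine (ae_restrict_iff' measurableSet_Icc).2 (ae_of_all _ fun t ht => ?_)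
    rw [le_inv_mul_iff₀ hc]
    linarith [hL _ (hK t ht) (g t)]
  have hi' : Integrable (fun t => c⁻¹ * (L (pev γ t) (g t) + C))
      (volume.restrict (Set.Icc a b)) := (hi.add hcI).const_mul _
  have hsq : Integrable (fun t => ‖g t‖ ^ 2) (volume.restrict (Set.Icc a b)) := by
    refine hi'.mono' (hv.1.aestronglyMeasurable.norm.pow 2) ?_
    filter_upwards [hpt] with t ht
    simpa using ht
  refine ⟨(memLp_two_iff_integrable_sq_norm hv.1.aestronglyMeasurable).2 hsq, ?_⟩
  refine (integral_mono_ae hsq hi' hpt).trans ?_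
  rw [integral_const_mul, integral_add hi hcI, inv_mul_eq_div]
  gcongr

/-- Curves of bounded kinetic energy are uniformly equicontinuous. -/
lemma uniformEquicontinuous_of_integral_sq_le {ι : Type*} {a b : ℝ} {n : ℕ}
    {γs : ι → CPath a b n} {gs : ι → ℝ → Eu n} (hv : ∀ j, IsVelocity (γs j) (gs j))
    (hgs : ∀ j, MemLp (gs j) 2 (volume.restrict (Set.Icc a b))) {M : ℝ}
    (hM : ∀ j, ∫ t in Set.Icc a b, ‖gs j t‖ ^ 2 ≤ M) :
    UniformEquicontinuous fun j => (γs j : Set.Icc a b → Eu n) := by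
  rw [Metric.uniformEquicontinuous_iff]
  intro ε hε
  set N : ℝ := |M| + 1 with hN
  have hN0 : 0 < N := by positivity
  set η : ℝ := ε / (2 * N) with hη
  have hη0 : 0 < η := by positivity
  refine ⟨η * ε, by positivity, fun s t hst j => ?_⟩
  have hsub : Set.uIoc (t : ℝ) s ⊆ Set.Icc a b :=
    Set.uIoc_subset_uIcc.trans (Set.uIcc_subset_Icc t.2 s.2)
  have hi := (hgs j).integrable_norm_pow (by norm_num : (2 : ℕ) ≠ 0)
  have hI : IntegrableOn (fun u => ‖gs j u‖ ^ 2) (Set.uIoc (t : ℝ) s) := by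
    exact IntegrableOn.mono_set hi hsub
  have h1I : IntegrableOn (fun _ => η⁻¹ / 4) (Set.uIoc (t : ℝ) s) :=
    integrableOn_const (by simp [Set.uIoc])
  rw [dist_eq_norm, (hv j).2 t s, add_sub_cancel_left]
  have h1 : ‖∫ u in (t : ℝ)..s, gs j u‖ ≤
      ∫ u in Set.uIoc (t : ℝ) s, (η * ‖gs j u‖ ^ 2 + η⁻¹ / 4) := by
    refine intervalIntegral.norm_integral_le_integral_norm_uIoc.trans
      (integral_mono ((hv j).1.mono_set hsub).norm ((hI.const_mul η).add h1I) fun u => ?_)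
    change ‖gs j u‖ ≤ η * ‖gs j u‖ ^ 2 + η⁻¹ / 4
    have : η * ‖gs j u‖ ^ 2 + η⁻¹ / 4 - ‖gs j u‖ = (η * ‖gs j u‖ - 1 / 2) ^ 2 / η := by
      field_simp
      ring
    have : 0 ≤ (η * ‖gs j u‖ - 1 / 2) ^ 2 / η := by positivity
    linarith
  rw [integral_add (hI.const_mul η) h1I, integral_const_mul, setIntegral_const] at h1
  have h2 : ∫ u in Set.uIoc (t : ℝ) s, ‖gs j u‖ ^ 2 ≤ N := by
    refine (setIntegral_mono_set hi (ae_of_all _ fun _ => by positivity)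
      (LE.le.eventuallyLE hsub)).trans ((hM j).trans ?_)
    linarith [le_abs_self M]
  have h3 : volume.real (Set.uIoc (t : ℝ) s) = dist s t := by
    rw [Measure.real, Real.volume_uIoc, ENNReal.toReal_ofReal (abs_nonneg _)]
    rfl
  rw [h3, smul_eq_mul] at h1
  have h4 : η * N = ε / 2 := by
    rw [hη]
    field_simp
  have h5 : dist s t * (η⁻¹ / 4) < ε / 4 := by
    calc dist s t * (η⁻¹ / 4) < η * ε * (η⁻¹ / 4) := by gcongr
      _ = ε / 4 := by field_simp
  have h6 := mul_le_mul_of_nonneg_left h2 hη0.le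
  linarith

/-- Minimizers between compact sets have uniformly bounded action. -/
lemma exists_action_le_of_mem_gammaMin {n : ℕ} {a b : ℝ} (hab : a < b) {L : Eu n → Eu n → ℝ}
    (hL : Continuous (Function.uncurry L)) {K₁ K₂ : Set (Eu n)} (hK₁ : IsCompact K₁)
    (hK₂ : IsCompact K₂) : ∃ A : ℝ, ∀ γ ∈ GammaMin L a b K₁ K₂, action L a b γ ≤ A := by
  obtain ⟨R₁, hR₁⟩ := hK₁.isBounded.exists_norm_le
  obtain ⟨R₂, hR₂⟩ := hK₂.isBounded.exists_norm_le
  have hba : 0 < b - a := sub_pos.2 hab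
  obtain ⟨B, -, hB⟩ := exists_bound_of_isCompact hL
    (isCompact_closedBall (0 : Eu n) (R₁ + (R₁ + R₂)))
    (isCompact_closedBall (0 : Eu n) ((b - a)⁻¹ * (R₁ + R₂)))
  refine ⟨∫ _ in Set.Icc a b, B, fun γ hγ => ?_⟩
  obtain ⟨-, ha, hb, hmin⟩ := hγ
  set x := pev γ a with hx
  set y := pev γ b with hy
  set v : Eu n := (b - a)⁻¹ • (y - x) with hv
  have hxy : ‖y - x‖ ≤ R₁ + R₂ := by
    linarith [norm_sub_le y x, hR₁ x ha, hR₂ y hb]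
  have hvB : ‖v‖ ≤ (b - a)⁻¹ * (R₁ + R₂) := by
    rw [hv, norm_smul, Real.norm_of_nonneg (inv_nonneg.2 hba.le)]
    gcongr
  let γ' : CPath a b n := ⟨fun t => x + ((t : ℝ) - a) • v, by fun_prop⟩
  have hγ' {t : ℝ} (ht : t ∈ Set.Icc a b) : pev γ' t = x + (t - a) • v := pev_of_mem γ' ht
  have hvel : IsVelocity γ' fun _ => v := by
    refine ⟨integrableOn_const (by simp), fun s t => ?_⟩
    change x + ((t : ℝ) - a) • v = x + ((s : ℝ) - a) • v + _
    rw [intervalIntegral.integral_const]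
    module
  have hpos {t : ℝ} (ht : t ∈ Set.Icc a b) : ‖pev γ' t‖ ≤ R₁ + (R₁ + R₂) := by
    rw [hγ' ht]
    refine (norm_add_le _ _).trans (add_le_add (hR₁ x ha) ?_)
    rw [norm_smul, Real.norm_of_nonneg (sub_nonneg.2 ht.1)]
    calc (t - a) * ‖v‖ ≤ (b - a) * ((b - a)⁻¹ * (R₁ + R₂)) := by
          gcongr
          exact ht.2
      _ = R₁ + R₂ := mul_inv_cancel_left₀ hba.ne' _
  have hbound (t : ℝ) (ht : t ∈ Set.Icc a b) : |L (pev γ' t) v| ≤ B :=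
    hB _ (mem_closedBall_zero_iff.2 (hpos ht)) _ (mem_closedBall_zero_iff.2 hvB)
  refine (hmin γ' hvel.isACC ?_ ?_).trans ((hvel.action_le_coe_iff L _).2 ?_)
  · simp [hγ' (Set.left_mem_Icc.2 hab.le)]
  · rw [hγ' (Set.right_mem_Icc.2 hab.le), hv, smul_inv_smul₀ hba.ne', add_sub_cancel]
  · have hi : IntegrableOn (fun t => L (pev γ' t) v) (Set.Icc a b) :=
      IntegrableOn.of_bound measure_Icc_lt_top
        (aestronglyMeasurable_comp_pev hL γ' subset_rfl aestronglyMeasurable_const) B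
        ((ae_restrict_iff' measurableSet_Icc).2 (ae_of_all _ hbound))
    exact ⟨hi, setIntegral_mono_on hi (integrableOn_const (by simp)) measurableSet_Icc
      fun t ht => (le_abs_self _).trans (hbound t ht)⟩

/-- A uniformly bounded and equicontinuous closed set of curves is compact. -/
lemma isCompact_of_isClosed_of_equicontinuous {X E : Type*} [TopologicalSpace X] [CompactSpace X]
    [MetricSpace E] {K : Set E} (hK : IsCompact K) {S : Set C(X, E)} (hS : IsClosed S)
    (hSK : ∀ f ∈ S, ∀ x, f x ∈ K) (heq : Equicontinuous fun f : S => (f : X → E)) :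
    IsCompact S := by
  let e := ContinuousMap.equivBoundedOfCompact X E
  have he : Isometry e := ContinuousMap.isometryEquivBoundedOfCompact X E |>.isometry
  have hc : IsCompact (e '' S) := by
    refine BoundedContinuousFunction.arzela_ascoli₂ K hK (e '' S) ?_ ?_ ?_
    · exact (ContinuousMap.isometryEquivBoundedOfCompact X E).toHomeomorph.isClosedMap _ hS
    · rintro _ x ⟨f, hf, rfl⟩
      exact hSK f hf x
    · exact heq.comp fun f : e '' S => ⟨e.symm f, by
        obtain ⟨-, f, hf, rfl⟩ := f
        simpa using hf⟩
  exact he.isEmbedding.isCompact_iff.2 hc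

/-- **Compactness of the set of minimizing extremals (Lemma 3.6).**
For all compact sets `K₁, K₂ ⊆ ℝⁿ`, the set `Γ^min_{K₁,K₂}` of minimizing extremals from
`K₁` to `K₂` is compact in `(C([a,b];ℝⁿ), d_Γ)`. -/
theorem gammaMin_compact
    {n : ℕ} (hn : 1 ≤ n) {a b : ℝ} (hab : a < b)
    (L : Eu n → Eu n → ℝ)
    (hL1 : ContDiff ℝ (⊤ : ℕ∞) (Function.uncurry L))
    (hL2 : ∀ K : Set (Eu n), IsCompact K → ∃ c₀ : ℝ, 0 < c₀ ∧
      ∀ x ∈ K, ∀ v w : Eu n, c₀ * ‖w‖ ^ 2 ≤ fderiv ℝ (fderiv ℝ (L x)) v w w)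
    (c₁ c₂ : ℝ) (hc₁ : 0 < c₁) (hc₂ : 0 < c₂)
    (hL3 : ∀ x v : Eu n, c₁ * ‖v‖ - c₂ ≤ L x v)
    (K₁ K₂ : Set (Eu n)) (hK₁ : IsCompact K₁) (hK₂ : IsCompact K₂) :
    IsCompact (GammaMin L a b K₁ K₂) := by
  have hL : Continuous (Function.uncurry L) := hL1.continuous
  have hdL : Continuous (Function.uncurry fun x v => fderiv ℝ (L x) v) := by
    have h : ContDiff ℝ (⊤ : ℕ∞) (Function.uncurry fun z : Eu n × Eu n => L z.1) :=
      hL1.comp (contDiff_fst.fst.prodMk contDiff_snd)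
    exact (h.fderiv (n := 0) contDiff_snd (by simp)).continuous
  have hLx (x : Eu n) : ContDiff ℝ 2 (L x) :=
    contDiff_infty.1 (hL1.comp (contDiff_prodMk_right x)) 2
  have hconv (x v u : Eu n) : L x v + fderiv ℝ (L x) v (u - v) ≤ L x u := by
    obtain ⟨c, hc, h⟩ := hL2 {x} isCompact_singleton
    have := add_fderiv_add_le_of_le_fderiv_fderiv (hLx x) (h x rfl) v u
    have : 0 ≤ c / 2 * ‖u - v‖ ^ 2 := by positivity
    linarith
  have hLc (x v : Eu n) : -c₂ ≤ L x v := by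
    have : 0 ≤ c₁ * ‖v‖ := by positivity
    linarith [hL3 x v]
  obtain ⟨A, hA⟩ := exists_action_le_of_mem_gammaMin hab hL hK₁ hK₂
  obtain ⟨R₁, hR₁⟩ := hK₁.isBounded.exists_norm_le
  set R : ℝ := R₁ + (A + ∫ _ in Set.Icc a b, c₂) / c₁ with hR
  set K : Set (Eu n) := Metric.closedBall 0 R with hKdef
  have hK : IsCompact K := isCompact_closedBall _ _
  obtain ⟨c, hc, hcK⟩ := hL2 K hK
  obtain ⟨C, hC⟩ := exists_mul_sq_sub_le hL hdL hK hc fun x hx =>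
    add_fderiv_add_le_of_le_fderiv_fderiv (hLx x) (hcK x hx)
  choose! g hg using fun (γ : CPath a b n) (hγ : γ ∈ GammaMin L a b K₁ K₂) => hγ.1
  have hg (γ) (hγ : γ ∈ GammaMin L a b K₁ K₂) : IsVelocity γ (g γ) := hg γ hγ
  have hmem (γ) (hγ : γ ∈ GammaMin L a b K₁ K₂) (t : ℝ) (ht : t ∈ Set.Icc a b) :
      pev γ t ∈ K := by
    rw [hKdef, mem_closedBall_zero_iff, hR]
    exact ((hg γ hγ).norm_pev_le_of_action_le hc₁ hL3 (hA γ hγ) ht).trans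
      (add_le_add_left (hR₁ _ hγ.2.1) _)
  have hE (γ) (hγ : γ ∈ GammaMin L a b K₁ K₂) :=
    (hg γ hγ).memLp_two_of_action_le (by positivity) hC (hmem γ hγ) (hA γ hγ)
  have hclosed : IsClosed (GammaMin L a b K₁ K₂) := by
    refine isSeqClosed_iff_isClosed.1 fun γs γ hγs hγ => ?_
    have hlsc {A' : ℝ} (h : ∀ᶠ j in atTop, action L a b (γs j) ≤ A') :
        IsACC γ ∧ action L a b γ ≤ A' := by
      obtain ⟨N, hN⟩ := eventually_atTop.1 h
      exact isACC_and_action_le_of_tendsto hL hdL hconv hLc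
        (hγ.comp (tendsto_add_atTop_nat N)) (fun j => hg _ (hγs (j + N)))
        (fun j => (hE _ (hγs (j + N))).1) (fun j => (hE _ (hγs (j + N))).2)
        fun j => hN _ (Nat.le_add_left N j)
    have hlim (t : ℝ) : Tendsto (fun j => pev (γs j) t) atTop (𝓝 (pev γ t)) :=
      ((continuous_pev t).tendsto γ).comp hγ
    refine ⟨(hlsc (Eventually.of_forall fun j => hA _ (hγs j))).1,
      hK₁.isClosed.mem_of_tendsto (hlim a) (Eventually.of_forall fun j => (hγs j).2.1),
      hK₂.isClosed.mem_of_tendsto (hlim b) (Eventually.of_forall fun j => (hγs j).2.2.1),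
      fun γ' hγ' hγ'a hγ'b => ?_⟩
    refine EReal.le_of_forall_lt_iff_le.1 fun A' hA' => ?_
    obtain ⟨A₀, h1, h2⟩ := EReal.lt_iff_exists_real_btwn.1 hA'
    have h2 : A₀ < A' := EReal.coe_lt_coe_iff.1 h2
    obtain ⟨η, hη, hcomp⟩ := exists_competitor hab hL γ' hγ' h1.le (sub_pos.2 h2)
    rw [add_sub_cancel, hγ'a, hγ'b] at hcomp
    refine (hlsc ?_).2
    filter_upwards [Metric.tendsto_nhds.1 (hlim a) η hη,
      Metric.tendsto_nhds.1 (hlim b) η hη] with j hja hjb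
    rw [dist_comm, dist_eq_norm] at hja
    rw [dist_eq_norm] at hjb
    obtain ⟨β, hβ, hβa, hβb, hβA⟩ := hcomp _ _ hja.le hjb.le
    exact ((hγs j).2.2.2 β hβ hβa hβb).trans hβA
  refine isCompact_of_isClosed_of_equicontinuous hK hclosed (fun γ hγ t => ?_) ?_
  · rw [← pev_of_mem γ t.2]
    exact hmem γ hγ t t.2
  · exact (uniformEquicontinuous_of_integral_sq_le
      (γs := fun γ : GammaMin L a b K₁ K₂ => (γ : CPath a b n)) (fun γ => hg γ γ.2)
      (fun γ => (hE γ γ.2).1) fun γ => (hE γ γ.2).2).equicontinuous
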